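/- arXiv:2003.06024 — 11 statements merged into one kernel-verified Lean document; each statement's English description precedes it below -/
import Mathlib

section
/- Let A ∈ ℝ^{m1×m1} and B ∈ ℝ^{m2×m2} be invertible matrices, set Y_i' = A·Y_i·B for i = 1, …, n, and let ℓ' denote the log-likelihood function for the transformed data Y_1', …, Y_n'. Then for all (Ψ1, Ψ2) ∈ PD(m1) × PD(m2): ℓ'(Ψ1, Ψ2) = ℓ(Aᵀ Ψ1 A, B Ψ2 Bᵀ) − 2·n·m2·log|det A| − 2·n·m1·log|det B|. In particular, the log-likelihood surface of the transformed data is a translation of that of the original data. -/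
open Matrix

/-- The matrix normal log-likelihood function. -/
noncomputable def ell {m1 m2 n : ℕ} (Y : Fin n → Matrix (Fin m1) (Fin m2) ℝ)
    (Ψ1 : Matrix (Fin m1) (Fin m1) ℝ) (Ψ2 : Matrix (Fin m2) (Fin m2) ℝ) : ℝ :=
  (n : ℝ) * m2 * Real.log Ψ1.det + (n : ℝ) * m1 * Real.log Ψ2.det
    - (Ψ1 * ∑ i, Y i * Ψ2 * (Y i)ᵀ).trace

/-- For invertible `A`, `B` and transformed data `Y_i' = A·Y_i·B`, the log-likelihood `ℓ'`
of the transformed data satisfies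
`ℓ'(Ψ1, Ψ2) = ℓ(Aᵀ Ψ1 A, B Ψ2 Bᵀ) − 2 n m2 log|det A| − 2 n m1 log|det B|`
for all `(Ψ1, Ψ2) ∈ PD(m1) × PD(m2)`. -/
theorem stmt1 {m1 m2 n : ℕ} (Y : Fin n → Matrix (Fin m1) (Fin m2) ℝ)
    (A : Matrix (Fin m1) (Fin m1) ℝ) (B : Matrix (Fin m2) (Fin m2) ℝ)
    (hA : IsUnit A.det) (hB : IsUnit B.det) :
    ∀ (Ψ1 : Matrix (Fin m1) (Fin m1) ℝ) (Ψ2 : Matrix (Fin m2) (Fin m2) ℝ),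
      Ψ1.PosDef → Ψ2.PosDef →
      ell (fun i => A * Y i * B) Ψ1 Ψ2
        = ell Y (Aᵀ * Ψ1 * A) (B * Ψ2 * Bᵀ)
          - 2 * (n : ℝ) * m2 * Real.log |A.det| - 2 * (n : ℝ) * m1 * Real.log |B.det| := by
  intro Ψ1 Ψ2 h1 h2
  have hA0 : A.det ≠ 0 := hA.ne_zero
  have hB0 : B.det ≠ 0 := hB.ne_zero
  have h10 : Ψ1.det ≠ 0 := h1.det_pos.ne'
  have h20 : Ψ2.det ≠ 0 := h2.det_pos.ne'
  have e1 : Real.log (Aᵀ * Ψ1 * A).det = Real.log Ψ1.det + 2 * Real.log A.det := by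
    rw [det_mul, det_mul, det_transpose, Real.log_mul (mul_ne_zero hA0 h10) hA0,
      Real.log_mul hA0 h10]
    ring
  have e2 : Real.log (B * Ψ2 * Bᵀ).det = Real.log Ψ2.det + 2 * Real.log B.det := by
    rw [det_mul, det_mul, det_transpose, Real.log_mul (mul_ne_zero hB0 h20) hB0,
      Real.log_mul hB0 h20]
    ring
  have e3 : (Ψ1 * ∑ i, (A * Y i * B) * Ψ2 * (A * Y i * B)ᵀ).trace
      = ((Aᵀ * Ψ1 * A) * ∑ i, Y i * (B * Ψ2 * Bᵀ) * (Y i)ᵀ).trace := by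
    rw [Matrix.mul_sum, Matrix.mul_sum, trace_sum, trace_sum]
    refine Finset.sum_congr rfl fun i _ => ?_
    have : Aᵀ * Ψ1 * A * (Y i * (B * Ψ2 * Bᵀ) * (Y i)ᵀ)
        = Aᵀ * (Ψ1 * A * (Y i * (B * Ψ2 * Bᵀ) * (Y i)ᵀ)) := by
      simp only [Matrix.mul_assoc]
    rw [this, trace_mul_comm Aᵀ]
    simp only [transpose_mul, Matrix.mul_assoc]
  unfold ell
  rw [e1, e2, e3, Real.log_abs, Real.log_abs]
  ring
end

section
/- Suppose the m1 × m1 matrix Σ_{i=1}^n Y_i Y_iᵀ is invertible. Then for every Ψ2 ∈ PD(m2), the matrix Σ_{i=1}^n Y_i Ψ2 Y_iᵀ is positive definite, and the matrix Ψ1* = ((1/(n·m2)) · Σ_{i=1}^n Y_i Ψ2 Y_iᵀ)^{−1} is the unique maximizer over PD(m1) of the section Ψ1 ↦ ℓ(Ψ1, Ψ2); that is, ℓ(Ψ1, Ψ2) ≤ ℓ(Ψ1*, Ψ2) for all Ψ1 ∈ PD(m1), with equality if and only if Ψ1 = Ψ1*. -/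
open Matrix

theorem logdet_aux {m : ℕ} (M : Matrix (Fin m) (Fin m) ℝ) (hM : M.PosDef) :
    Real.log M.det ≤ M.trace - m ∧ (Real.log M.det = M.trace - m → M = 1) := by
  have hpos := hM.eigenvalues_pos
  have hdet : Real.log M.det = ∑ i, Real.log (hM.1.eigenvalues i) := by
    rw [hM.1.det_eq_prod_eigenvalues]
    simp only [RCLike.ofReal_real_eq_id, id]
    exact Real.log_prod (fun i _ => (hpos i).ne')
  have htr : M.trace - m = ∑ i, (hM.1.eigenvalues i - 1) := by
    rw [hM.1.trace_eq_sum_eigenvalues]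
    simp
  have hle : ∀ i ∈ Finset.univ, Real.log (hM.1.eigenvalues i) ≤ hM.1.eigenvalues i - 1 :=
    fun i _ => Real.log_le_sub_one_of_pos (hpos i)
  rw [hdet, htr]
  refine ⟨Finset.sum_le_sum hle, fun h => ?_⟩
  rw [Finset.sum_eq_sum_iff_of_le hle] at h
  have h1 : ∀ i, hM.1.eigenvalues i = 1 := by
    intro i
    by_contra hne
    exact (Real.log_lt_sub_one_of_pos (hpos i) hne).ne (h i (Finset.mem_univ i))
  have hs := hM.1.spectral_theorem
  have h2 : (RCLike.ofReal ∘ hM.1.eigenvalues : Fin m → ℝ) = fun _ => 1 := by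
    funext i
    simp [h1 i]
  rw [h2] at hs
  rw [hs]
  simp

theorem logdet_pair {m : ℕ} (P T : Matrix (Fin m) (Fin m) ℝ) (hP : P.PosDef) (hT : T.PosDef) :
    Real.log P.det + Real.log T.det ≤ (P * T).trace - m ∧
    (Real.log P.det + Real.log T.det = (P * T).trace - m → P = T⁻¹) := by
  obtain ⟨B, hB⟩ : ∃ B : Matrix (Fin m) (Fin m) ℝ, T = Bᴴ * B := by
    open scoped MatrixOrder in
    exact CStarAlgebra.nonneg_iff_eq_star_mul_self.mp hT.posSemidef.nonneg
  have hdT := hT.det_pos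
  have hdP := hP.det_pos
  have hBdet : IsUnit B.det := by
    rw [isUnit_iff_ne_zero]
    intro h
    rw [hB, det_mul, h] at hdT
    simp at hdT
  have hBu : IsUnit B := (Matrix.isUnit_iff_isUnit_det B).2 hBdet
  have hM : (B * P * Bᴴ).PosDef :=
    (Matrix.IsUnit.posDef_star_right_conjugate_iff hBu).2 hP
  obtain ⟨h1, h2⟩ := logdet_aux _ hM
  have e1 : Real.log (B * P * Bᴴ).det = Real.log P.det + Real.log T.det := by
    rw [← Real.log_mul hdP.ne' hdT.ne', hB]
    simp only [det_mul]
    congr 1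
    ring
  have e2 : (B * P * Bᴴ).trace = (P * T).trace := by
    rw [hB, Matrix.trace_mul_comm, ← Matrix.mul_assoc, Matrix.trace_mul_comm]
  rw [e1, e2] at h1 h2
  refine ⟨h1, fun h => ?_⟩
  have h3 := h2 h
  have h4 : P * Bᴴ * B = 1 := by
    rw [Matrix.mul_assoc] at h3
    exact mul_eq_one_comm.1 h3
  symm
  apply Matrix.inv_eq_left_inv
  rw [hB, ← Matrix.mul_assoc, h4]

/-- If `Σᵢ Yᵢ Yᵢᵀ` is invertible then for every `Ψ2 ∈ PD(m2)` the matrix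
`Σᵢ Yᵢ Ψ2 Yᵢᵀ` is positive definite and
`Ψ1* = ((1/(n m2)) Σᵢ Yᵢ Ψ2 Yᵢᵀ)⁻¹` is the unique maximizer of `Ψ1 ↦ ℓ(Ψ1, Ψ2)`
over `PD(m1)`. -/
theorem stmt2 {m1 m2 n : ℕ} (hn : 0 < n) (hm1 : 0 < m1) (hm2 : 0 < m2)
    (Y : Fin n → Matrix (Fin m1) (Fin m2) ℝ)
    (hinv : IsUnit (∑ i, Y i * (Y i)ᵀ).det)
    (Ψ2 : Matrix (Fin m2) (Fin m2) ℝ) (hΨ2 : Ψ2.PosDef) :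
    (∑ i, Y i * Ψ2 * (Y i)ᵀ).PosDef ∧
    ((((n : ℝ) * m2)⁻¹ • ∑ i, Y i * Ψ2 * (Y i)ᵀ)⁻¹).PosDef ∧
    (∀ Ψ1 : Matrix (Fin m1) (Fin m1) ℝ, Ψ1.PosDef →
      ell Y Ψ1 Ψ2 ≤ ell Y ((((n : ℝ) * m2)⁻¹ • ∑ i, Y i * Ψ2 * (Y i)ᵀ)⁻¹) Ψ2) ∧
    (∀ Ψ1 : Matrix (Fin m1) (Fin m1) ℝ, Ψ1.PosDef →
      (ell Y Ψ1 Ψ2 = ell Y ((((n : ℝ) * m2)⁻¹ • ∑ i, Y i * Ψ2 * (Y i)ᵀ)⁻¹) Ψ2 ↔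
        Ψ1 = (((n : ℝ) * m2)⁻¹ • ∑ i, Y i * Ψ2 * (Y i)ᵀ)⁻¹)) := by
  have hS : (∑ i, Y i * Ψ2 * (Y i)ᵀ).PosDef := by
    have hterm : ∀ i, (Y i * Ψ2 * (Y i)ᵀ).PosSemidef := fun i => by
      simpa using hΨ2.posSemidef.mul_mul_conjTranspose_same (Y i)
    have hsd : (∑ i, Y i * Ψ2 * (Y i)ᵀ).PosSemidef :=
      Matrix.posSemidef_sum _ (fun i _ => hterm i)
    refine Matrix.PosDef.of_dotProduct_mulVec_pos hsd.1 (fun {x} hx => ?_)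
    refine lt_of_le_of_ne (hsd.dotProduct_mulVec_nonneg x) (fun h0 => hx ?_)
    rw [Matrix.sum_mulVec, dotProduct_sum] at h0
    have hz := (Finset.sum_eq_zero_iff_of_nonneg
      (fun i _ => (hterm i).dotProduct_mulVec_nonneg x)).1 h0.symm
    have hy : ∀ i, (Y i)ᵀ *ᵥ x = 0 := by
      intro i
      by_contra hne
      have hp := hΨ2.dotProduct_mulVec_pos hne
      have hzi := hz i (Finset.mem_univ i)
      rw [← Matrix.mulVec_mulVec, ← Matrix.mulVec_mulVec, Matrix.dotProduct_mulVec] at hzi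
      simp only [star_trivial, Matrix.mulVec_transpose] at hp hzi
      exact hp.ne' hzi
    have hk : (∑ i, Y i * (Y i)ᵀ) *ᵥ x = 0 := by
      rw [Matrix.sum_mulVec]
      refine Finset.sum_eq_zero (fun i _ => ?_)
      rw [← Matrix.mulVec_mulVec, hy i, Matrix.mulVec_zero]
    exact Matrix.eq_zero_of_mulVec_eq_zero hinv.ne_zero hk
  have hc : (0 : ℝ) < (n : ℝ) * m2 := by positivity
  set S := ∑ i, Y i * Ψ2 * (Y i)ᵀ with hSdef
  set c : ℝ := (n : ℝ) * m2 with hcdef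
  have hT : (c⁻¹ • S).PosDef := hS.smul (inv_pos.2 hc)
  set T := c⁻¹ • S with hTdef
  have hST : S = c • T := by
    rw [hTdef, smul_smul, mul_inv_cancel₀ hc.ne', one_smul]
  have hell : ∀ P, ell Y P Ψ2 =
      c * (Real.log P.det - (P * T).trace) + (n : ℝ) * m1 * Real.log Ψ2.det := by
    intro P
    unfold ell
    rw [← hSdef, ← hcdef, hST, Matrix.mul_smul, Matrix.trace_smul, smul_eq_mul]
    ring
  have hstar : ell Y T⁻¹ Ψ2 =
      c * (- Real.log T.det - m1) + (n : ℝ) * m1 * Real.log Ψ2.det := by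
    have hu : IsUnit T.det := hT.det_pos.ne'.isUnit
    rw [hell, Matrix.nonsing_inv_mul T hu, Matrix.det_nonsing_inv]
    simp
  refine ⟨hS, hT.inv, fun P hP => ?_, fun P hP => ⟨fun h => ?_, fun h => by rw [h]⟩⟩
  · rw [hell, hstar]
    have := (logdet_pair P T hP hT).1
    have := mul_le_mul_of_nonneg_left
      (show Real.log P.det - (P * T).trace ≤ - Real.log T.det - m1 by linarith) hc.le
    linarith
  · rw [hell, hstar] at h
    apply (logdet_pair P T hP hT).2
    have := mul_left_cancel₀ hc.ne' (add_right_cancel h)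
    linarith
end

section
/- Let A, B ∈ ℝ^{m×m} be symmetric positive semidefinite matrices such that A + B is positive definite, and let r = rank(A). Then there exists a real polynomial p of degree exactly r (with positive leading coefficient) such that det(γ·A + B) = p(γ) for all γ ∈ ℝ. -/
open Matrix Polynomial

open scoped MatrixOrder in
lemma exists_factor_of_posSemidef {m : ℕ} {S : Matrix (Fin m) (Fin m) ℝ} (hS : S.PosSemidef) :
    ∃ R : Matrix (Fin m) (Fin m) ℝ, S = Rᴴ * R :=
  CStarAlgebra.nonneg_iff_eq_star_mul_self.mp hS.nonneg

/-- If `A`, `B` are positive semidefinite with `A + B` positive definite and `rank A = r`,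
then `γ ↦ det(γ·A + B)` is a polynomial of degree exactly `r` with positive leading
coefficient. -/
theorem stmt3 {m : ℕ} (A B : Matrix (Fin m) (Fin m) ℝ)
    (hA : A.PosSemidef) (hB : B.PosSemidef) (hAB : (A + B).PosDef) :
    ∃ p : Polynomial ℝ, p.degree = (A.rank : WithBot ℕ) ∧ 0 < p.leadingCoeff ∧
      ∀ γ : ℝ, (γ • A + B).det = p.eval γ := by
  have hS : 0 < (A + B).det := hAB.det_pos
  obtain ⟨R, hR⟩ : ∃ R : Matrix (Fin m) (Fin m) ℝ, A + B = Rᴴ * R :=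
    exists_factor_of_posSemidef hAB.posSemidef
  have hRd : IsUnit R.det := by
    rw [hR, det_mul] at hS
    exact isUnit_iff_ne_zero.mpr (right_ne_zero_of_mul hS.ne')
  have hRd' : IsUnit (R⁻¹).det := by
    rw [det_nonsing_inv]; exact hRd.ringInverse
  have hRd'' : IsUnit (R⁻¹ᴴ).det := by
    rw [det_conjTranspose]; exact hRd'.star
  have hA' : (R⁻¹ᴴ * A * R⁻¹).PosSemidef := hA.conjTranspose_mul_mul_same _
  have hrank : (R⁻¹ᴴ * A * R⁻¹).rank = A.rank := by
    rw [rank_mul_eq_left_of_isUnit_det _ _ hRd', rank_mul_eq_right_of_isUnit_det _ _ hRd'']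
  have hAeq : A = Rᴴ * (R⁻¹ᴴ * A * R⁻¹) * R := by
    have h1 : Rᴴ * R⁻¹ᴴ = 1 := by
      rw [← conjTranspose_mul, nonsing_inv_mul _ hRd, conjTranspose_one]
    calc A = (Rᴴ * R⁻¹ᴴ) * A * (R⁻¹ * R) := by rw [h1, nonsing_inv_mul _ hRd]; simp
      _ = _ := by simp only [Matrix.mul_assoc]
  generalize R⁻¹ᴴ * A * R⁻¹ = M at hA' hrank hAeq
  have hM := hA'.isHermitian
  set d := hM.eigenvalues with hd
  have hdn : ∀ i, 0 ≤ d i := hA'.eigenvalues_nonneg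
  have hr : A.rank = ∑ i, if d i ≠ 0 then 1 else 0 := by
    rw [← hrank, hM.rank_eq_card_non_zero_eigs, Fintype.card_subtype, Finset.card_filter]
  obtain ⟨U, V, hUV, hMU⟩ : ∃ U V : Matrix (Fin m) (Fin m) ℝ, U * V = 1 ∧
      M = U * diagonal d * V := by
    refine ⟨hM.eigenvectorUnitary, star (hM.eigenvectorUnitary : Matrix (Fin m) (Fin m) ℝ),
      by simp, ?_⟩
    have := hM.spectral_theorem
    rw [Unitary.conjStarAlgAut_apply] at this
    exact this
  have hl : ∀ i, 0 < (C (d i) * X + C (1 - d i)).leadingCoeff := by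
    intro i
    by_cases h : d i = 0
    · simp [h]
    · rw [leadingCoeff_linear h]; exact lt_of_le_of_ne (hdn i) (Ne.symm h)
  refine ⟨C (A + B).det * ∏ i, (C (d i) * X + C (1 - d i)), ?_, ?_, ?_⟩
  · rw [degree_mul, degree_C hS.ne', degree_prod, hr, zero_add]
    push_cast
    refine Finset.sum_congr rfl fun i _ => ?_
    by_cases h : d i = 0
    · simp [h]
    · rw [degree_linear h]; simp [h]
  · rw [leadingCoeff_mul, leadingCoeff_C, leadingCoeff_prod]
    exact mul_pos hS (Finset.prod_pos fun i _ => hl i)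
  · intro γ
    have h1 : γ • A + B = Rᴴ * (U * diagonal (fun i => d i * γ + (1 - d i)) * V) * R := by
      have h2 : (diagonal (fun i => d i * γ + (1 - d i)) : Matrix (Fin m) (Fin m) ℝ)
          = 1 + (γ - 1) • diagonal d := by
        rw [← diagonal_one, ← diagonal_smul, diagonal_add]
        congr 1; ext i; simp; ring
      have h3 : γ • A + B = (A + B) + (γ - 1) • A := by
        rw [sub_smul, one_smul]; abel
      rw [h2, h3, Matrix.mul_add, Matrix.add_mul, Matrix.mul_one, hUV, Matrix.mul_smul,
        Matrix.smul_mul, ← hMU, Matrix.mul_add, Matrix.add_mul, Matrix.mul_one, Matrix.mul_smul,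
        Matrix.smul_mul, ← hAeq, hR]
    have h4 : U.det * V.det = 1 := by rw [← det_mul, hUV, det_one]
    rw [h1, hR]
    simp only [det_mul, det_diagonal, eval_mul, eval_C, eval_prod, eval_add, eval_X]
    linear_combination (Rᴴ.det * R.det * ∏ i, (d i * γ + (1 - d i))) * h4
end

section
/- Suppose the m1 × (n·m2) concatenated matrix Y = (Y_1, …, Y_n) has rank m1, and suppose that every singular matrix X ∈ ℝ^{m2×m2} satisfies m2 · rank(Y_1X, …, Y_nX) ≥ m1 · rank(X). Then the log-likelihood function ℓ is bounded above on PD(m1) × PD(m2). -/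
open Matrix

/-- Horizontal concatenation. -/
def concat {m1 m2 n : ℕ} (Y : Fin n → Matrix (Fin m1) (Fin m2) ℝ) :
    Matrix (Fin m1) (Fin n × Fin m2) ℝ :=
  Matrix.of fun i p => Y p.1 i p.2

/-- Scalar and matrix log-trace inequality. -/
lemma aux_logdet {m : ℕ} (a : ℝ) (ha : 0 ≤ a) (P : Matrix (Fin m) (Fin m) ℝ) (hP : P.PosDef) :
    a * Real.log P.det - P.trace ≤ m * (a * Real.log a - a) := by
  have key : ∀ x : ℝ, 0 < x → a * Real.log x - x ≤ a * Real.log a - a := by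
    intro x hx
    rcases ha.eq_or_lt with rfl | ha
    · simp; exact hx.le
    · have := Real.log_le_sub_one_of_pos (div_pos hx ha)
      rw [Real.log_div hx.ne' ha.ne'] at this
      have h2 := mul_le_mul_of_nonneg_left this ha.le
      have h3 : a * (x / a - 1) = x - a := by field_simp
      rw [h3] at h2
      linarith
  have hd := hP.isHermitian.det_eq_prod_eigenvalues
  have ht := hP.isHermitian.trace_eq_sum_eigenvalues
  simp only [RCLike.ofReal_real_eq_id, id] at hd ht
  rw [hd, ht, Real.log_prod (fun i _ => (hP.eigenvalues_pos i).ne'), Finset.mul_sum,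
    ← Finset.sum_sub_distrib]
  calc _ ≤ ∑ i : Fin m, (a * Real.log a - a) :=
        Finset.sum_le_sum fun i _ => key _ (hP.eigenvalues_pos i)
    _ = _ := by simp; ring

/-- Abel summation inequality. -/
lemma aux_abel (m1 m2 : ℕ) (g : ℕ → ℝ) (hg : Antitone g) (x : Fin m1 → ℕ)
    (hx : ∀ t, x t < m2)
    (hc : ∀ k ≤ m2, m1 * k ≤ m2 * (Finset.univ.filter fun t => x t < k).card) :
    (m1 : ℝ) * ∑ j ∈ Finset.range m2, g j ≤ m2 * ∑ t, g (x t) := by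
  have rep : ∀ j, j < m2 → g j = g m2 +
      ∑ k ∈ Finset.range m2, (if j < k + 1 then (g k - g (k + 1)) else 0) := by
    intro j hj
    have : ∀ M, j ≤ M → g j = g M +
      ∑ k ∈ Finset.range M, (if j < k + 1 then (g k - g (k + 1)) else 0) := by
      intro M hM
      induction M, hM using Nat.le_induction with
      | base =>
        rw [Finset.sum_eq_zero]; · simp
        intro k hk
        rw [Finset.mem_range] at hk
        rw [if_neg (by omega)]
      | succ M hM ih =>
        rw [Finset.sum_range_succ, if_pos (by omega)]
        linarith
    exact this m2 hj.le
  have h1 : ∑ j ∈ Finset.range m2, g j = m2 * g m2 +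
      ∑ k ∈ Finset.range m2, ((k + 1 : ℕ) : ℝ) * (g k - g (k + 1)) := by
    rw [Finset.sum_congr rfl fun j hj => rep j (Finset.mem_range.1 hj), Finset.sum_add_distrib,
      Finset.sum_comm]
    congr 1
    · simp
    · refine Finset.sum_congr rfl fun k hk => ?_
      rw [← Finset.sum_filter, Finset.sum_const, nsmul_eq_mul]
      congr 2
      have : (Finset.range m2).filter (fun j => j < k + 1) = Finset.range (k + 1) := by
        ext j; simp at hk ⊢; omega
      rw [this, Finset.card_range]
  have h2 : ∑ t, g (x t) = m1 * g m2 +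
      ∑ k ∈ Finset.range m2, ((Finset.univ.filter fun t => x t < k + 1).card : ℝ) *
        (g k - g (k + 1)) := by
    rw [Finset.sum_congr rfl fun t _ => rep (x t) (hx t), Finset.sum_add_distrib,
      Finset.sum_comm]
    congr 1
    · simp
    · refine Finset.sum_congr rfl fun k hk => ?_
      rw [← Finset.sum_filter, Finset.sum_const, nsmul_eq_mul]
  rw [h1, h2, mul_add, mul_add, Finset.mul_sum, Finset.mul_sum]
  have : ∑ k ∈ Finset.range m2, (m1 : ℝ) * (((k + 1 : ℕ) : ℝ) * (g k - g (k + 1))) ≤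
      ∑ k ∈ Finset.range m2, (m2 : ℝ) * (((Finset.univ.filter fun t => x t < k + 1).card : ℝ) *
        (g k - g (k + 1))) := by
    refine Finset.sum_le_sum fun k hk => ?_
    rw [← mul_assoc, ← mul_assoc]
    refine mul_le_mul_of_nonneg_right ?_ (sub_nonneg.2 (hg (Nat.le_succ k)))
    exact_mod_cast hc (k + 1) (Finset.mem_range.1 hk)
  nlinarith

/-- Good column selections. -/
def Good {m1 m2 n : ℕ} (s : Fin m1 → Fin n × Fin m2) : Prop :=
  Function.Injective s ∧
    ∀ k ≤ m2, m1 * k ≤ m2 * (Finset.univ.filter fun t => ((s t).2 : ℕ) < k).card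

lemma aux_abel' {m1 m2 n : ℕ} (l : Fin m2 → ℝ) (hl : Antitone l)
    (s : Fin m1 → Fin n × Fin m2) (hs : Good s) :
    (m1 : ℝ) * ∑ j, l j ≤ m2 * ∑ t, l (s t).2 := by
  rcases Nat.eq_zero_or_pos m2 with rfl | hm
  · simp
  let g : ℕ → ℝ := fun j => l ⟨min j (m2 - 1), by omega⟩
  have hg : Antitone g := fun a b hab => hl (by
    simp only [Fin.mk_le_mk]; omega)
  have hgl : ∀ j : Fin m2, g j = l j := fun j => by
    simp only [g]; congr 1; ext; simp; omega
  have := aux_abel m1 m2 g hg (fun t => (s t).2) (fun t => (s t).2.2) hs.2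
  rw [Finset.sum_range] at this
  simpa only [hgl] using this

lemma concat_mul {m1 m2 n : ℕ} (Y : Fin n → Matrix (Fin m1) (Fin m2) ℝ)
    (X : Matrix (Fin m2) (Fin m2) ℝ) :
    (concat fun i => Y i * X) =
      concat Y * Matrix.of (fun p q : Fin n × Fin m2 => if p.1 = q.1 then X p.2 q.2 else 0) := by
  ext a p
  simp [concat, Matrix.mul_apply, Fintype.sum_prod_type]

/-- Greedy basis. -/
lemma aux_greedy {ι V : Type*} [AddCommGroup V] [Module ℝ V] (v : ι → V) (f : ι → ℕ) (k : ℕ) :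
    ∃ T : Set ι, T ⊆ {p | f p < k} ∧ LinearIndepOn ℝ v T ∧
      ∀ j ≤ k, ∀ p, f p < j → v p ∈ Submodule.span ℝ (v '' (T ∩ {q | f q < j})) := by
  induction k with
  | zero =>
    refine ⟨∅, by simp, linearIndepOn_empty _ _, ?_⟩
    intro j hj p hp
    omega
  | succ k ih =>
    obtain ⟨T, hT, hli, hsp⟩ := ih
    obtain ⟨b, hbt, hTb, hspan, hb⟩ := exists_linearIndepOn_extension (t := {p | f p < k + 1}) hli
      (fun p hp => Nat.lt_succ_of_lt (hT hp))
    refine ⟨b, hbt, hb, ?_⟩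
    intro j hj p hp
    rcases Nat.lt_or_ge j (k + 1) with h | h
    · refine Submodule.span_mono ?_ (hsp j (by omega) p hp)
      exact Set.image_mono (Set.inter_subset_inter_left _ hTb)
    · obtain rfl : j = k + 1 := by omega
      rw [Set.inter_eq_left.2 hbt]
      exact hspan ⟨p, hp, rfl⟩

lemma aux_exists {m1 m2 n : ℕ} (Y : Fin n → Matrix (Fin m1) (Fin m2) ℝ)
    (hY : (concat Y).rank = m1)
    (h : ∀ X : Matrix (Fin m2) (Fin m2) ℝ, X.det = 0 →
      m1 * X.rank ≤ m2 * (concat fun i => Y i * X).rank)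
    (U : Matrix (Fin m2) (Fin m2) ℝ) (hU : U * Uᵀ = 1) :
    ∃ s : Fin m1 → Fin n × Fin m2, Good s ∧
      ((concat fun i => Y i * U).submatrix id s).det ≠ 0 := by
  classical
  set W := concat fun i => Y i * U with hW
  have hUd : IsUnit U.det := by
    rw [← Matrix.isUnit_iff_isUnit_det]; exact IsUnit.of_mul_eq_one _ hU
  obtain ⟨T, hT, hli, hsp⟩ := aux_greedy W.col (fun p : Fin n × Fin m2 => (p.2 : ℕ)) m2
  -- rank bound
  have hrk : ∀ j ≤ m2, (concat fun i => Y i * (U * diagonal fun a : Fin m2 =>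
      if (a : ℕ) < j then (1 : ℝ) else 0)).rank ≤
        (T.toFinset.filter fun q => (q.2 : ℕ) < j).card := by
    intro j hj
    rw [Matrix.rank_eq_finrank_span_cols]
    have hle : Submodule.span ℝ (Set.range (concat fun i => Y i * (U * diagonal fun a : Fin m2 =>
      if (a : ℕ) < j then (1 : ℝ) else 0)).col) ≤
        Submodule.span ℝ (((T.toFinset.filter fun q => (q.2 : ℕ) < j).image W.col : Finset _) :
          Set (Fin m1 → ℝ)) := by
      rw [Submodule.span_le]
      rintro _ ⟨p, rfl⟩
      have hcol : (concat fun i => Y i * (U * diagonal fun a : Fin m2 =>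
          if (a : ℕ) < j then (1 : ℝ) else 0)).col p =
          if (p.2 : ℕ) < j then W.col p else 0 := by
        ext a
        simp only [concat, Matrix.col_apply, Matrix.of_apply, ← Matrix.mul_assoc,
          Matrix.mul_diagonal, hW]
        split_ifs <;> simp [concat]
      rw [hcol]
      split_ifs with hp
      · have := hsp j hj p hp
        refine Submodule.span_mono ?_ this
        rintro _ ⟨q, ⟨hq, hq'⟩, rfl⟩
        simp only [Finset.coe_image, Finset.coe_filter, Set.mem_toFinset]
        exact ⟨q, ⟨hq, hq'⟩, rfl⟩
      · exact Submodule.zero_mem _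
    refine (Submodule.finrank_mono hle).trans ?_
    exact (finrank_span_finset_le_card _).trans Finset.card_image_le
  have hrkW : m1 ≤ W.rank := by
    have e : Y = fun i => (Y i * U) * Uᵀ := by
      funext i; rw [Matrix.mul_assoc, hU, Matrix.mul_one]
    calc m1 = (concat Y).rank := hY.symm
      _ = (concat fun i => (Y i * U) * Uᵀ).rank := by rw [← e]
      _ ≤ W.rank := by rw [concat_mul]; exact Matrix.rank_mul_le_left _ _
  have hfull : (diagonal fun a : Fin m2 => if (a : ℕ) < m2 then (1 : ℝ) else 0) = 1 := by
    rw [← Matrix.diagonal_one]; congr 1; ext a; simp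
  have hcard1 : m1 ≤ T.toFinset.card := by
    have := hrk m2 le_rfl
    rw [hfull, Matrix.mul_one] at this
    exact hrkW.trans (this.trans (Finset.card_filter_le _ _))
  have hcard2 : T.toFinset.card ≤ m1 := by
    have := hli.fintype_card_le_finrank
    simpa [Set.toFinset_card] using this
  have hcard : Fintype.card T = m1 := by rw [← Set.toFinset_card]; omega
  let e : Fin m1 ≃ T := (Fintype.equivFinOfCardEq hcard).symm
  refine ⟨fun t => (e t : Fin n × Fin m2), ⟨?_, ?_⟩, ?_⟩
  · exact Subtype.val_injective.comp e.injective
  · intro k hk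
    have hcnt : (T.toFinset.filter fun q => (q.2 : ℕ) < k).card =
        (Finset.univ.filter fun t => (((e t : Fin n × Fin m2)).2 : ℕ) < k).card := by
      symm
      refine Finset.card_bij (fun t _ => (e t : Fin n × Fin m2)) ?_ ?_ ?_
      · intro t ht
        simpa using ht
      · intro a _ b _ hab
        exact e.injective (Subtype.ext hab)
      · intro q hq
        simp only [Finset.mem_filter, Set.mem_toFinset] at hq
        exact ⟨e.symm ⟨q, hq.1⟩, by simpa using hq.2, by simp⟩
    rw [← hcnt]
    rcases hk.lt_or_eq with hk' | rfl
    · have hdet : (U * diagonal fun a : Fin m2 => if (a : ℕ) < k then (1 : ℝ) else 0).det = 0 := by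
        rw [Matrix.det_mul, Matrix.det_diagonal,
          Finset.prod_eq_zero (Finset.mem_univ (⟨k, hk'⟩ : Fin m2)) (by simp), mul_zero]
      have hr : (U * diagonal fun a : Fin m2 => if (a : ℕ) < k then (1 : ℝ) else 0).rank = k := by
        rw [Matrix.rank_mul_eq_right_of_isUnit_det _ _ hUd, Matrix.rank_diagonal]
        have : ∀ a : Fin m2, ((if (a : ℕ) < k then (1 : ℝ) else 0) ≠ 0) ↔ (a : ℕ) < k := by
          intro a; split_ifs <;> simp [*]
        simp only [this]
        rw [Fintype.card_subtype, Fin.card_filter_val_lt]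
        omega
      have h1 := h _ hdet
      rw [hr] at h1
      exact h1.trans (Nat.mul_le_mul_left _ (hrk k hk))
    · have := hrk k le_rfl
      rw [hfull, Matrix.mul_one] at this
      rw [mul_comm]
      exact Nat.mul_le_mul_left _ (hrkW.trans this)
  · have : LinearIndependent ℝ (W.submatrix id fun t => (e t : Fin n × Fin m2)).col := by
      have h1 := hli.linearIndependent
      exact h1.comp e e.injective
    rw [Matrix.linearIndependent_cols_iff_isUnit, Matrix.isUnit_iff_isUnit_det] at this
    exact this.ne_zero

lemma aux_compact (m : ℕ) : IsCompact {U : Matrix (Fin m) (Fin m) ℝ | U * Uᵀ = 1} := by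
  have hK : IsCompact (Set.univ.pi fun _ : Fin m => Set.univ.pi fun _ : Fin m =>
      Set.Icc (-1 : ℝ) 1) :=
    isCompact_univ_pi fun _ => isCompact_univ_pi fun _ => isCompact_Icc
  refine hK.of_isClosed_subset (isClosed_eq (by fun_prop) continuous_const) ?_
  intro (U : Matrix (Fin m) (Fin m) ℝ) hU
  have hU' : U ∈ Matrix.unitaryGroup (Fin m) ℝ := by
    rw [Matrix.mem_unitaryGroup_iff]
    have hU2 : U * Uᵀ = 1 := hU
    simpa [Matrix.star_eq_conjTranspose] using hU2
  intro i _ j _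
  have := entry_norm_bound_of_unitary hU' i j
  rwa [Real.norm_eq_abs, abs_le] at this

lemma aux_uniform {m1 m2 n : ℕ} (Y : Fin n → Matrix (Fin m1) (Fin m2) ℝ)
    (hY : (concat Y).rank = m1)
    (h : ∀ X : Matrix (Fin m2) (Fin m2) ℝ, X.det = 0 →
      m1 * X.rank ≤ m2 * (concat fun i => Y i * X).rank) :
    ∃ c > (0 : ℝ), ∀ U : Matrix (Fin m2) (Fin m2) ℝ, U * Uᵀ = 1 →
      ∃ s : Fin m1 → Fin n × Fin m2, Good s ∧
        c ≤ |((concat fun i => Y i * U).submatrix id s).det| := by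
  refine (aux_compact m2).induction_on
    (p := fun K => ∃ c > (0 : ℝ), ∀ U ∈ K,
      ∃ s : Fin m1 → Fin n × Fin m2, Good s ∧
        c ≤ |((concat fun i => Y i * U).submatrix id s).det|) ?_ ?_ ?_ ?_
  · exact ⟨1, one_pos, by simp⟩
  · rintro K L hKL ⟨c, hc, hL⟩
    exact ⟨c, hc, fun U hU => hL U (hKL hU)⟩
  · rintro K L ⟨c, hc, hK⟩ ⟨d, hd, hL⟩
    refine ⟨min c d, lt_min hc hd, ?_⟩
    rintro U (hU | hU)
    · obtain ⟨s, hs, hs'⟩ := hK U hU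
      exact ⟨s, hs, (min_le_left _ _).trans hs'⟩
    · obtain ⟨s, hs, hs'⟩ := hL U hU
      exact ⟨s, hs, (min_le_right _ _).trans hs'⟩
  · intro U hU
    obtain ⟨s, hs, hdet⟩ := aux_exists Y hY h U hU
    have hcont : Continuous fun V : Matrix (Fin m2) (Fin m2) ℝ =>
        |((concat fun i => Y i * V).submatrix id s).det| := by
      refine (Continuous.matrix_det ?_).abs
      refine continuous_matrix fun a b => ?_
      simp only [concat, Matrix.submatrix_apply, Matrix.of_apply, Matrix.mul_apply]
      refine continuous_finset_sum _ fun x _ => continuous_const.mul ?_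
      exact continuous_id.matrix_elem _ _
    have hpos := abs_pos.2 hdet
    refine ⟨_, mem_nhdsWithin_of_mem_nhds
      (hcont.continuousAt.eventually (lt_mem_nhds (half_lt_self hpos))), _, half_pos hpos, ?_⟩
    intro V hV
    exact ⟨s, hs, le_of_lt hV⟩

lemma aux_spectral {m : ℕ} (A : Matrix (Fin m) (Fin m) ℝ) (hA : A.PosDef) :
    ∃ (U : Matrix (Fin m) (Fin m) ℝ) (l : Fin m → ℝ), U * Uᵀ = 1 ∧ Antitone l ∧
      (∀ j, 0 < l j) ∧ A = U * diagonal l * Uᵀ := by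
  let V : Matrix (Fin m) (Fin m) ℝ := hA.isHermitian.eigenvectorUnitary
  let μ := hA.isHermitian.eigenvalues
  have hV : V * Vᵀ = 1 := by
    have := Matrix.mem_unitaryGroup_iff.1 hA.isHermitian.eigenvectorUnitary.2
    simpa [Matrix.star_eq_conjTranspose] using this
  have hA' : A = V * diagonal μ * Vᵀ := by
    have := hA.isHermitian.spectral_theorem
    simpa [Unitary.conjStarAlgAut_apply, Matrix.star_eq_conjTranspose] using this
  let σ := Tuple.sort (fun j => - μ j)
  have hσ : Monotone ((fun j => - μ j) ∘ σ) := Tuple.monotone_sort _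
  refine ⟨V.submatrix id σ, μ ∘ σ, ?_, ?_, fun j => hA.eigenvalues_pos _, ?_⟩
  · rw [Matrix.transpose_submatrix, Matrix.submatrix_mul_equiv, hV, Matrix.submatrix_id_id]
  · intro a b hab
    have := hσ hab
    simpa using this
  · rw [← Matrix.submatrix_diagonal_equiv, Matrix.submatrix_mul_equiv, Matrix.transpose_submatrix,
      Matrix.submatrix_mul_equiv, ← hA', Matrix.submatrix_id_id]

/-- If the concatenated data matrix has full row rank `m1` and every singular
`X ∈ ℝ^{m2×m2}` satisfies `m2 · rank(Y_1X, …, Y_nX) ≥ m1 · rank(X)`, then the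
log-likelihood `ℓ` is bounded above on `PD(m1) × PD(m2)`. -/
theorem stmt6 {m1 m2 n : ℕ} (Y : Fin n → Matrix (Fin m1) (Fin m2) ℝ)
    (hY : (concat Y).rank = m1)
    (h : ∀ X : Matrix (Fin m2) (Fin m2) ℝ, X.det = 0 →
      m1 * X.rank ≤ m2 * (concat fun i => Y i * X).rank) :
    ∃ C : ℝ, ∀ (Ψ1 : Matrix (Fin m1) (Fin m1) ℝ) (Ψ2 : Matrix (Fin m2) (Fin m2) ℝ),
      Ψ1.PosDef → Ψ2.PosDef → ell Y Ψ1 Ψ2 ≤ C := by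
  obtain ⟨c, hc, hunif⟩ := aux_uniform Y hY h
  set a : ℝ := (n : ℝ) * m2 with ha
  have ha0 : 0 ≤ a := by positivity
  refine ⟨m1 * (a * Real.log a - a) - 2 * a * Real.log c, ?_⟩
  intro Ψ1 Ψ2 h1 h2
  obtain ⟨U, l, hU, hl, hlpos, hΨ2⟩ := aux_spectral Ψ2 h2
  obtain ⟨s, hs, hsc⟩ := hunif U hU
  set W := concat fun i => Y i * U with hW
  set B := W.submatrix id s with hB
  have hBdet : B.det ≠ 0 := abs_pos.1 (hc.trans_le hsc)
  let D : Matrix (Fin m1) (Fin m1) ℝ := diagonal fun t => Real.sqrt (l (s t).2)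
  have hDdet : D.det ^ 2 = ∏ t, l (s t).2 := by
    rw [Matrix.det_diagonal, ← Finset.prod_pow]
    exact Finset.prod_congr rfl fun t _ => Real.sq_sqrt (hlpos _).le
  have hprod : 0 < ∏ t, l (s t).2 := Finset.prod_pos fun t _ => hlpos _
  have hD0 : D.det ≠ 0 := by
    intro h0; rw [h0] at hDdet; simp at hDdet; exact hprod.ne hDdet
  have hBD : IsUnit (B * D) := by
    rw [Matrix.isUnit_iff_isUnit_det, Matrix.det_mul]
    exact (mul_ne_zero hBdet hD0).isUnit
  have hP := h1.conjTranspose_mul_mul_same (Matrix.mulVec_injective_of_isUnit hBD)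
  have hlog := aux_logdet a ha0 _ hP
  rw [Matrix.conjTranspose_eq_transpose_of_trivial] at hlog
  have hPdet : ((B * D)ᵀ * Ψ1 * (B * D)).det = Ψ1.det * (B.det ^ 2 * ∏ t, l (s t).2) := by
    rw [← hDdet]; simp only [Matrix.det_mul, Matrix.det_transpose]; ring
  have hlogdet : Real.log ((B * D)ᵀ * Ψ1 * (B * D)).det =
      Real.log Ψ1.det + (2 * Real.log |B.det| + ∑ t, Real.log (l (s t).2)) := by
    rw [hPdet, Real.log_mul h1.det_pos.ne' (by positivity), Real.log_mul (by positivity) hprod.ne',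
      Real.log_pow, Real.log_prod (fun t _ => (hlpos _).ne'), Real.log_abs]
    push_cast; ring
  -- traces
  have hQ : (Wᵀ * Ψ1 * W).PosSemidef := by
    have := h1.posSemidef.conjTranspose_mul_mul_same W
    rwa [Matrix.conjTranspose_eq_transpose_of_trivial] at this
  have hPtr : ((B * D)ᵀ * Ψ1 * (B * D)).trace =
      ∑ t, l (s t).2 * (Wᵀ * Ψ1 * W) (s t) (s t) := by
    have e : (B * D)ᵀ * Ψ1 * (B * D) = D * ((Wᵀ * Ψ1 * W).submatrix s s) * D := by
      have e2 : (Wᵀ * Ψ1 * W).submatrix s s = Bᵀ * Ψ1 * B := by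
        ext i j; simp [hB, Matrix.mul_apply]
      rw [e2, Matrix.transpose_mul, Matrix.diagonal_transpose]
      simp only [Matrix.mul_assoc]; rfl
    rw [e, Matrix.trace]
    refine Finset.sum_congr rfl fun t _ => ?_
    simp only [D, Matrix.diag_apply, Matrix.mul_diagonal, Matrix.diagonal_mul,
      Matrix.submatrix_apply]
    rw [mul_right_comm, Real.mul_self_sqrt (hlpos _).le]
  have hAtr : (Ψ1 * ∑ i, Y i * Ψ2 * (Y i)ᵀ).trace =
      ∑ p : Fin n × Fin m2, l p.2 * (Wᵀ * Ψ1 * W) p p := by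
    have e : ∑ i, Y i * Ψ2 * (Y i)ᵀ = W * diagonal (fun p : Fin n × Fin m2 => l p.2) * Wᵀ := by
      have e1 : ∀ i, Y i * Ψ2 * (Y i)ᵀ = (Y i * U) * diagonal l * (Y i * U)ᵀ := by
        intro i; rw [hΨ2, Matrix.transpose_mul]; simp only [Matrix.mul_assoc]
      rw [Finset.sum_congr rfl fun i _ => e1 i]
      ext x y
      rw [Matrix.sum_apply, Matrix.mul_apply, Fintype.sum_prod_type]
      refine Finset.sum_congr rfl fun i _ => ?_
      rw [Matrix.mul_apply]
      refine Finset.sum_congr rfl fun j _ => ?_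
      simp only [Matrix.mul_diagonal, Matrix.transpose_apply, hW, concat, Matrix.of_apply]
    rw [e, ← Matrix.mul_assoc, Matrix.trace_mul_comm, ← Matrix.mul_assoc, ← Matrix.mul_assoc,
      Matrix.trace]
    refine Finset.sum_congr rfl fun p _ => ?_
    rw [Matrix.diag_apply, Matrix.mul_diagonal, mul_comm]
  have htr : ((B * D)ᵀ * Ψ1 * (B * D)).trace ≤ (Ψ1 * ∑ i, Y i * Ψ2 * (Y i)ᵀ).trace := by
    rw [hPtr, hAtr]
    rw [← Finset.sum_image (s := Finset.univ) (g := s)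
      (f := fun p => l p.2 * (Wᵀ * Ψ1 * W) p p) (fun x _ y _ hxy => hs.1 hxy)]
    exact Finset.sum_le_sum_of_subset_of_nonneg (Finset.subset_univ _)
      fun p _ _ => mul_nonneg (hlpos _).le hQ.diag_nonneg
  have hdet2 : Real.log Ψ2.det = ∑ j, Real.log (l j) := by
    have : U.det * U.det = 1 := by
      have := congrArg Matrix.det hU
      simpa using this
    rw [← Real.log_prod (fun j _ => (hlpos j).ne'), hΨ2, Matrix.det_mul, Matrix.det_mul,
      Matrix.det_transpose, mul_right_comm, this, one_mul, Matrix.det_diagonal]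
  have habel := aux_abel' (fun j => Real.log (l j))
    (fun i j hij => Real.log_le_log (hlpos _) (hl hij)) s hs
  have hlogc : Real.log c ≤ Real.log |B.det| := Real.log_le_log hc hsc
  rw [hlogdet] at hlog
  unfold ell
  rw [hdet2]
  have f1 := mul_le_mul_of_nonneg_left hlogc ha0
  have f2 := mul_le_mul_of_nonneg_left habel (Nat.cast_nonneg (α := ℝ) n)
  simp only [← mul_assoc] at f2
  rw [← ha] at f2 ⊢
  linarith
end

section
/- Suppose m1 = n·m2 and the square m1 × m1 matrix Y = (Y_1, …, Y_n) obtained by horizontal concatenation is invertible. Then the negated profile log-likelihood is constant: g(Ψ) = 2·m2·log|det Y| for every Ψ ∈ PD(m2). (In particular, for n = 1 and square invertible data Y_1 ∈ ℝ^{m×m}, g(Ψ) = 2·m·log|det Y_1| for all Ψ ∈ PD(m).) -/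
open Matrix

/-- The negated profile log-likelihood. -/
noncomputable def gfun {m1 m2 n : ℕ} (Y : Fin n → Matrix (Fin m1) (Fin m2) ℝ)
    (Ψ : Matrix (Fin m2) (Fin m2) ℝ) : ℝ :=
  (m2 : ℝ) * Real.log (∑ i, Y i * Ψ * (Y i)ᵀ).det - (m1 : ℝ) * Real.log Ψ.det

/-- The concatenated matrix viewed as a square `(n·m2) × (n·m2)` matrix when `m1 = n·m2`. -/
def concatSq {m2 n : ℕ} (Y : Fin n → Matrix (Fin (n * m2)) (Fin m2) ℝ) :
    Matrix (Fin (n * m2)) (Fin (n * m2)) ℝ :=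
  (concat Y).submatrix id finProdFinEquiv.symm

open scoped Kronecker in
theorem sum_eq_concatSq {m2 n : ℕ} (Y : Fin n → Matrix (Fin (n * m2)) (Fin m2) ℝ)
    (Ψ : Matrix (Fin m2) (Fin m2) ℝ) :
    ∑ i, Y i * Ψ * (Y i)ᵀ = concatSq Y *
      (((1 : Matrix (Fin n) (Fin n) ℝ) ⊗ₖ Ψ).submatrix finProdFinEquiv.symm finProdFinEquiv.symm) *
        (concatSq Y)ᵀ := by
  have h : concatSq Y *
      (((1 : Matrix (Fin n) (Fin n) ℝ) ⊗ₖ Ψ).submatrix finProdFinEquiv.symm finProdFinEquiv.symm) *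
        (concatSq Y)ᵀ = concat Y * ((1 : Matrix (Fin n) (Fin n) ℝ) ⊗ₖ Ψ) * (concat Y)ᵀ := by
    unfold concatSq
    rw [Matrix.transpose_submatrix, Matrix.submatrix_mul_equiv, Matrix.submatrix_mul_equiv]
    simp
  rw [h]
  ext a b
  simp [Matrix.mul_apply, Matrix.sum_apply, concat, Fintype.sum_prod_type, Matrix.one_apply]

/-- If `m1 = n·m2` and the square concatenated matrix `Y = (Y_1, …, Y_n)` is invertible,
then the negated profile log-likelihood is constant: `g(Ψ) = 2·m2·log|det Y|` for every
`Ψ ∈ PD(m2)`. -/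
theorem stmt8 {m2 n : ℕ} (Y : Fin n → Matrix (Fin (n * m2)) (Fin m2) ℝ)
    (hY : IsUnit (concatSq Y).det) :
    ∀ Ψ : Matrix (Fin m2) (Fin m2) ℝ, Ψ.PosDef →
      gfun Y Ψ = 2 * (m2 : ℝ) * Real.log |(concatSq Y).det| := by
  intro Ψ hΨ
  have hy : (concatSq Y).det ≠ 0 := hY.ne_zero
  have hp : Ψ.det ≠ 0 := hΨ.det_pos.ne'
  unfold gfun
  rw [sum_eq_concatSq, Matrix.det_mul, Matrix.det_mul, Matrix.det_transpose,
    Matrix.det_submatrix_equiv_self, Matrix.det_kronecker, Real.log_abs]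
  simp only [Matrix.det_one, one_pow, one_mul, Fintype.card_fin]
  rw [Real.log_mul (mul_ne_zero hy (pow_ne_zero _ hp)) hy, Real.log_mul hy (pow_ne_zero _ hp),
    Real.log_pow]
  push_cast
  ring
end

section
/- Let m1 = m2 = 2, n = 2, Y_1 = I_2, and Y_2 = [[a, b], [−b, a]] with a, b ∈ ℝ and b ≠ 0. Then for every Ψ ∈ PD(2), g(Ψ) ≥ 4·log(1 + a² + b²), with equality if and only if Ψ = λ·I_2 for some λ > 0. In other words, the minimizers of the negated profile log-likelihood g over PD(2) are exactly the positive multiples of the identity. -/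
open Matrix

/-- For `n = 2`, `Y_1 = I_2`, `Y_2 = [[a, b], [−b, a]]` with `b ≠ 0`, the negated profile
log-likelihood satisfies `g(Ψ) ≥ 4·log(1 + a² + b²)` for every `Ψ ∈ PD(2)`, with equality
iff `Ψ` is a positive multiple of the identity. -/
theorem stmt10 (a b : ℝ) (hb : b ≠ 0) :
    ∀ Ψ : Matrix (Fin 2) (Fin 2) ℝ, Ψ.PosDef →
      (4 * Real.log (1 + a ^ 2 + b ^ 2) ≤
        gfun ![(1 : Matrix (Fin 2) (Fin 2) ℝ), !![a, b; -b, a]] Ψ ∧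
      (gfun ![(1 : Matrix (Fin 2) (Fin 2) ℝ), !![a, b; -b, a]] Ψ
          = 4 * Real.log (1 + a ^ 2 + b ^ 2) ↔
        ∃ lam : ℝ, 0 < lam ∧ Ψ = lam • (1 : Matrix (Fin 2) (Fin 2) ℝ))) := by
  intro Ψ hΨ
  have hsym : Ψ 1 0 = Ψ 0 1 := by simpa using hΨ.isHermitian.apply 0 1
  have hd : 0 < Ψ.det := hΨ.det_pos
  have hp : 0 < Ψ 0 0 := hΨ.diag_pos
  have hs : 0 < 1 + a ^ 2 + b ^ 2 := by positivity
  set E : ℝ := b ^ 2 * ((Ψ 0 0 - Ψ 1 1) ^ 2 + 4 * (Ψ 0 1) ^ 2) with hE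
  have hE0 : 0 ≤ E := by positivity
  have hb2 : 0 < b ^ 2 := by positivity
  have hD : (∑ i, (![(1 : Matrix (Fin 2) (Fin 2) ℝ), !![a, b; -b, a]]) i * Ψ *
      ((![(1 : Matrix (Fin 2) (Fin 2) ℝ), !![a, b; -b, a]]) i)ᵀ).det
      = (1 + a ^ 2 + b ^ 2) ^ 2 * Ψ.det + E := by
    rw [hE]
    simp [Fin.sum_univ_two, Matrix.det_fin_two, Matrix.vecMul, Matrix.mul_apply, dotProduct,
      Matrix.add_apply, hsym]
    ring
  have hA : 0 < (1 + a ^ 2 + b ^ 2) ^ 2 * Ψ.det := by positivity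
  have hlog : Real.log ((1 + a ^ 2 + b ^ 2) ^ 2 * Ψ.det)
      = 2 * Real.log (1 + a ^ 2 + b ^ 2) + Real.log Ψ.det := by
    rw [Real.log_mul (by positivity) hd.ne', Real.log_pow]
    norm_num
  have hg : gfun ![(1 : Matrix (Fin 2) (Fin 2) ℝ), !![a, b; -b, a]] Ψ
      = 2 * Real.log ((1 + a ^ 2 + b ^ 2) ^ 2 * Ψ.det + E) - 2 * Real.log Ψ.det := by
    rw [← hD]
    simp [gfun]
  rw [hg]
  have hle : Real.log ((1 + a ^ 2 + b ^ 2) ^ 2 * Ψ.det)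
      ≤ Real.log ((1 + a ^ 2 + b ^ 2) ^ 2 * Ψ.det + E) :=
    Real.log_le_log hA (by linarith)
  refine ⟨by linarith, ?_, ?_⟩
  · intro h
    have h1 : Real.log ((1 + a ^ 2 + b ^ 2) ^ 2 * Ψ.det + E)
        = Real.log ((1 + a ^ 2 + b ^ 2) ^ 2 * Ψ.det) := by linarith
    have h2 := Real.log_injOn_pos (Set.mem_Ioi.2 (by linarith)) (Set.mem_Ioi.2 hA) h1
    have h3 : E = 0 := by linarith
    have h4 : (Ψ 0 0 - Ψ 1 1) ^ 2 + 4 * (Ψ 0 1) ^ 2 = 0 := by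
      rcases mul_eq_zero.1 h3 with h | h
      · exact absurd h hb2.ne'
      · exact h
    have h5 : Ψ 0 1 = 0 := by
      apply pow_eq_zero_iff (two_ne_zero) |>.1
      nlinarith [sq_nonneg (Ψ 0 0 - Ψ 1 1), sq_nonneg (Ψ 0 1)]
    have h6 : Ψ 0 0 - Ψ 1 1 = 0 := by
      apply pow_eq_zero_iff (two_ne_zero) |>.1
      nlinarith [sq_nonneg (Ψ 0 0 - Ψ 1 1), sq_nonneg (Ψ 0 1)]
    refine ⟨Ψ 0 0, hp, ?_⟩
    ext i j
    fin_cases i <;> fin_cases j <;> simp [hsym, h5]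
    linarith
  · rintro ⟨lam, hl, h⟩
    have h3 : E = 0 := by
      rw [hE, h]
      simp
    rw [h3, add_zero]
    linarith
end

section
/- Let m1 = m2 = 2, n = 2, Y_1 = I_2, and Y_2 = diag(a, b) with a, b ∈ ℝ and a ≠ b. Then for every Ψ ∈ PD(2), g(Ψ) ≥ 2·log((1 + ab)² + (a − b)²), with equality if and only if the off-diagonal entry of Ψ is zero. In other words, the minimizers of the negated profile log-likelihood g over PD(2) are exactly the diagonal positive definite matrices; the likelihood achieves its maximum but not uniquely. -/
open Matrix

/-- For `n = 2`, `Y_1 = I_2`, `Y_2 = diag(a, b)` with `a ≠ b`, the negated profile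
log-likelihood satisfies `g(Ψ) ≥ 2·log((1 + ab)² + (a − b)²)` for every `Ψ ∈ PD(2)`, with
equality iff the off-diagonal entry of `Ψ` vanishes: the minimizers are exactly the
diagonal positive definite matrices. -/
theorem stmt11 (a b : ℝ) (hab : a ≠ b) :
    ∀ Ψ : Matrix (Fin 2) (Fin 2) ℝ, Ψ.PosDef →
      (2 * Real.log ((1 + a * b) ^ 2 + (a - b) ^ 2) ≤
        gfun ![(1 : Matrix (Fin 2) (Fin 2) ℝ), !![a, 0; 0, b]] Ψ ∧
      (gfun ![(1 : Matrix (Fin 2) (Fin 2) ℝ), !![a, 0; 0, b]] Ψ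
          = 2 * Real.log ((1 + a * b) ^ 2 + (a - b) ^ 2) ↔ Ψ 0 1 = 0)) := by
  intro Ψ hΨ
  have hd := hΨ.det_pos
  have hs : Ψ 1 0 = Ψ 0 1 := by
    have := hΨ.isHermitian.apply 0 1
    simpa using this
  have hC : (0 : ℝ) < (1 + a * b) ^ 2 + (a - b) ^ 2 := by
    have : 0 < (a - b) ^ 2 := by
      have := sub_ne_zero.mpr hab
      positivity
    positivity
  have hdet : (∑ i, (![(1 : Matrix (Fin 2) (Fin 2) ℝ), !![a, 0; 0, b]]) i * Ψ *
      ((![(1 : Matrix (Fin 2) (Fin 2) ℝ), !![a, 0; 0, b]]) i)ᵀ).det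
      = ((1 + a * b) ^ 2 + (a - b) ^ 2) * Ψ.det + (Ψ 0 1) ^ 2 * (a - b) ^ 2 := by
    simp [Fin.sum_univ_two, Matrix.det_fin_two, Matrix.vecMul, dotProduct, Matrix.mul_apply, hs]
    ring
  have hP := mul_pos hC hd
  have hg : gfun ![(1 : Matrix (Fin 2) (Fin 2) ℝ), !![a, 0; 0, b]] Ψ
      = 2 * Real.log (((1 + a * b) ^ 2 + (a - b) ^ 2) * Ψ.det + (Ψ 0 1) ^ 2 * (a - b) ^ 2)
        - 2 * Real.log Ψ.det := by
    unfold gfun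
    rw [hdet]
    norm_num
  have hl := Real.log_mul hC.ne' hd.ne'
  have hn : 0 ≤ (Ψ 0 1) ^ 2 * (a - b) ^ 2 := by positivity
  rw [hg]
  refine ⟨?_, ?_, ?_⟩
  · have := Real.log_le_log hP (le_add_of_nonneg_right hn)
    linarith
  · intro h
    have h1 : Real.log (((1 + a * b) ^ 2 + (a - b) ^ 2) * Ψ.det + (Ψ 0 1) ^ 2 * (a - b) ^ 2)
        = Real.log (((1 + a * b) ^ 2 + (a - b) ^ 2) * Ψ.det) := by linarith
    have h2 := Real.log_injOn_pos (Set.mem_Ioi.mpr (by linarith)) (Set.mem_Ioi.mpr hP) h1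
    have h3 : (Ψ 0 1) ^ 2 * (a - b) ^ 2 = 0 := by linarith
    have h4 := sub_ne_zero.mpr hab
    simpa [h4] using h3
  · intro h
    rw [h]
    simp only [ne_eq, OfNat.ofNat_ne_zero, not_false_eq_true, zero_pow, zero_mul, add_zero]
    linarith
end

section
/- Let m1 = m2 = 2, n = 2, Y_1 = I_2, and Y_2 = [[a, 1], [0, a]] with a ∈ ℝ. Then the infimum of g over PD(2) equals 4·log(1 + a²), and this infimum is not attained: g(Ψ) > 4·log(1 + a²) for every Ψ ∈ PD(2). In particular, the likelihood function is bounded but fails to achieve its maximum. -/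
open Matrix

lemma gfun_eq (a : ℝ) (P : Matrix (Fin 2) (Fin 2) ℝ) (h : P 1 0 = P 0 1) :
    gfun ![(1 : Matrix (Fin 2) (Fin 2) ℝ), !![a, 1; 0, a]] P =
      2 * Real.log ((1 + a ^ 2) ^ 2 * P.det + P 1 1 ^ 2) - 2 * Real.log P.det := by
  have key : (∑ i, (![(1 : Matrix (Fin 2) (Fin 2) ℝ), !![a, 1; 0, a]]) i * P *
      ((![(1 : Matrix (Fin 2) (Fin 2) ℝ), !![a, 1; 0, a]]) i)ᵀ).det =
      (1 + a ^ 2) ^ 2 * P.det + P 1 1 ^ 2 := by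
    rw [Fin.sum_univ_two]
    simp [Matrix.det_fin_two, Matrix.mul_apply, Fin.sum_univ_two, Matrix.vecMul, dotProduct, h]
    ring
  unfold gfun
  rw [key]
  norm_num

lemma gfun_gt (a : ℝ) (P : Matrix (Fin 2) (Fin 2) ℝ) (hP : P.PosDef) :
    4 * Real.log (1 + a ^ 2) <
        gfun ![(1 : Matrix (Fin 2) (Fin 2) ℝ), !![a, 1; 0, a]] P := by
  have hs : P 1 0 = P 0 1 := by simpa using hP.1.apply 0 1
  have hD : 0 < P.det := hP.det_pos
  have hr : 0 < P 1 1 := hP.diag_pos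
  have hc : 0 < 1 + a ^ 2 := by positivity
  rw [gfun_eq a P hs]
  have h1 : Real.log ((1 + a ^ 2) ^ 2 * P.det) <
      Real.log ((1 + a ^ 2) ^ 2 * P.det + P 1 1 ^ 2) :=
    Real.log_lt_log (by positivity) (by linarith [pow_pos hr 2])
  rw [Real.log_mul (by positivity) hD.ne', Real.log_pow] at h1
  push_cast at h1
  linarith

theorem stmt12 (a : ℝ) :
    IsGLB ((gfun ![(1 : Matrix (Fin 2) (Fin 2) ℝ), !![a, 1; 0, a]]) ''
        {Ψ : Matrix (Fin 2) (Fin 2) ℝ | Ψ.PosDef})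
      (4 * Real.log (1 + a ^ 2)) ∧
    ∀ Ψ : Matrix (Fin 2) (Fin 2) ℝ, Ψ.PosDef →
      4 * Real.log (1 + a ^ 2) <
        gfun ![(1 : Matrix (Fin 2) (Fin 2) ℝ), !![a, 1; 0, a]] Ψ := by
  refine ⟨⟨?_, ?_⟩, gfun_gt a⟩
  · rintro _ ⟨P, hP, rfl⟩
    exact (gfun_gt a P hP).le
  · intro b hb
    have hc : 0 < 1 + a ^ 2 := by positivity
    have hlim : Filter.Tendsto (fun e : ℝ => 2 * Real.log ((1 + a ^ 2) ^ 2 + e ^ 2))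
        (nhdsWithin 0 (Set.Ioi 0)) (nhds (4 * Real.log (1 + a ^ 2))) := by
      have hcont : ContinuousAt (fun e : ℝ => 2 * Real.log ((1 + a ^ 2) ^ 2 + e ^ 2)) 0 := by
        refine continuousAt_const.mul (ContinuousAt.log (by fun_prop) (by positivity))
      have h2 := hcont.tendsto
      have h3 : 2 * Real.log ((1 + a ^ 2) ^ 2 + (0 : ℝ) ^ 2) = 4 * Real.log (1 + a ^ 2) := by
        rw [zero_pow two_ne_zero, add_zero, Real.log_pow]
        push_cast
        ring
      rw [h3] at h2
      exact h2.mono_left nhdsWithin_le_nhds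
    refine ge_of_tendsto hlim ?_
    filter_upwards [self_mem_nhdsWithin] with e he
    have he : 0 < e := he
    have hP : (Matrix.diagonal ![e⁻¹, e]).PosDef := by
      refine Matrix.PosDef.diagonal ?_
      intro i
      fin_cases i <;> simp [he]
    have h4 := hb ⟨_, hP, rfl⟩
    rw [gfun_eq a _ (by simp)] at h4
    simpa [Matrix.det_diagonal, Fin.prod_univ_two, he.ne'] using h4
end

section
/- Let Y_1 and Y_2 be random 2×2 real matrices whose 8 entries are independent standard normal random variables. Then the probability that Y_1 is invertible and Y_1^{−1}Y_2 has only real eigenvalues — equivalently, that Y_1 is invertible and (tr(Y_1^{−1}Y_2))² − 4·det(Y_1^{−1}Y_2) ≥ 0 — equals π/4. -/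
open Matrix MeasureTheory ProbabilityTheory

/-- The first `2×2` matrix extracted from a sample of 8 reals. -/
def M1 (y : Fin 2 × Fin 2 × Fin 2 → ℝ) : Matrix (Fin 2) (Fin 2) ℝ :=
  Matrix.of fun i j => y (0, i, j)

/-- The second `2×2` matrix extracted from a sample of 8 reals. -/
def M2 (y : Fin 2 × Fin 2 × Fin 2 → ℝ) : Matrix (Fin 2) (Fin 2) ℝ :=
  Matrix.of fun i j => y (1, i, j)


/-- The arcsine-type integral over `[-1, 1]`. -/
lemma an_int1 (A : ℝ) (h0 : 0 ≤ A) (h1 : A < 1) :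
    ∫ w in (-1 : ℝ)..1, A * √(1 - w ^ 2) / (1 - A + A * w ^ 2) = Real.pi * (1 / √(1 - A) - 1) := by
  have hA : 0 < 1 - A := by linarith
  have hpos : ∀ w : ℝ, 0 < 1 - A + A * w ^ 2 := fun w => by positivity
  have key := intervalIntegral.integral_eq_sub_of_hasDerivAt_of_le
    (f := fun w => 1 / √(1 - A) * Real.arcsin (w / √(1 - A + A * w ^ 2)) - Real.arcsin w)
    (f' := fun w => A * √(1 - w ^ 2) / (1 - A + A * w ^ 2)) (a := -1) (b := 1) (by norm_num)
    ?_ ?_ ?_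
  · rw [key]
    have : 1 - A + A * 1 = 1 := by ring
    norm_num [this]
    ring
  · apply Continuous.continuousOn
    have : ∀ w : ℝ, √(1 - A + A * w ^ 2) ≠ 0 := fun w => (Real.sqrt_pos.2 (hpos w)).ne'
    have := Real.continuous_arcsin
    fun_prop (disch := assumption)
  · rintro w ⟨hw1, hw2⟩
    have hw : 0 < 1 - w ^ 2 := by nlinarith
    set q := √(1 - A + A * w ^ 2) with hq
    have hqpos : 0 < q := Real.sqrt_pos.2 (hpos w)
    have hq2 : q ^ 2 = 1 - A + A * w ^ 2 := Real.sq_sqrt (hpos w).le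
    set p := √(1 - w ^ 2) with hp
    have hppos : 0 < p := Real.sqrt_pos.2 hw
    have hp2 : p ^ 2 = 1 - w ^ 2 := Real.sq_sqrt hw.le
    set c := √(1 - A) with hc
    have hcpos : 0 < c := Real.sqrt_pos.2 hA
    have hc2 : c ^ 2 = 1 - A := Real.sq_sqrt hA.le
    have e1 : 1 - (w / q) ^ 2 = (c * p / q) ^ 2 := by
      field_simp
      rw [hq2, hc2, hp2]; ring
    have hlt : (w / q) ^ 2 < 1 := by
      have : 0 < (c * p / q) ^ 2 := by positivity
      linarith
    have hlt' := (sq_lt_one_iff_abs_lt_one _).1 hlt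
    rw [abs_lt] at hlt'
    have d1 := Real.hasDerivAt_arcsin hlt'.1.ne' hlt'.2.ne
    have d2 : HasDerivAt (fun w : ℝ => 1 - A + A * w ^ 2) (A * (2 * w)) w := by
      simpa using ((hasDerivAt_pow 2 w).const_mul A).const_add (1 - A)
    have d3 := (hasDerivAt_id w).div (d2.sqrt (hpos w).ne') hqpos.ne'
    have d4 := ((d1.comp w d3).const_mul (1 / c)).sub (Real.hasDerivAt_arcsin hw1.ne' hw2.ne)
    refine d4.congr_deriv ?_
    rw [e1, Real.sqrt_sq (by positivity), ← hp, ← hq, ← hq2]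
    simp only [id]
    field_simp
    have : A = (1 - q^2) / p^2 := by
      rw [hp2, hq2]; field_simp; ring
    rw [hc2, hp2]
    have hq4 : q ^ 4 = (1 - A + A * w ^ 2) * (1 - A + A * w ^ 2) := by rw [← hq2]; ring
    ring_nf
    try rw [hq4]
    try rw [hq2]
    ring
  · apply Continuous.intervalIntegrable
    have : ∀ w : ℝ, 1 - A + A * w ^ 2 ≠ 0 := fun w => (hpos w).ne'
    fun_prop (disch := assumption)

/-- substitution in the inner integral -/
lemma an_int2 (w : ℝ) (hw : 0 < 1 - w ^ 2) :
    ∫ t in (-√(1 - w ^ 2))..(√(1 - w ^ 2)),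
      (1 - t ^ 2 / (1 - w ^ 2)) / ((1 + w ^ 2 + t ^ 2) * √(1 + w ^ 2 + t ^ 2)) =
    ∫ a in (-(1 / √2))..(1 / √2), √(1 - w ^ 2) * (1 / (1 + w ^ 2) - a ^ 2 / (1 - a ^ 2 + a ^ 2 * w ^ 2)) := by
  obtain ⟨s, hs⟩ : ∃ s, s = 1 - w ^ 2 := ⟨_, rfl⟩
  have hb : 1 + w ^ 2 = 2 - s := by rw [hs]; ring
  rw [hb, ← hs]
  rw [← hs] at hw
  have hs1 : s ≤ 1 := by rw [hs]; nlinarith [sq_nonneg w]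
  have hb0 : 0 < 2 - s := by linarith
  have h2 : (1 / √2 : ℝ) ^ 2 = 1 / 2 := by
    rw [div_pow, Real.sq_sqrt (by norm_num)]; norm_num
  have h2p : 0 < (1 / √2 : ℝ) := by positivity
  have ha : ∀ a ∈ Set.uIcc (-(1 / √2)) (1 / √2 : ℝ), 0 < 1 - a ^ 2 * s := by
    intro a ha
    rw [Set.uIcc_of_le (by linarith)] at ha
    have : a ^ 2 ≤ (1 / √2) ^ 2 := sq_le_sq' ha.1 ha.2
    rw [h2] at this
    nlinarith [sq_nonneg a]
  set r := √((2 - s) * s) with hr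
  have hr2 : r ^ 2 = (2 - s) * s := Real.sq_sqrt (by positivity)
  have hrp : 0 < r := Real.sqrt_pos.2 (by positivity)
  have key := intervalIntegral.integral_comp_mul_deriv (a := -(1 / √2)) (b := 1 / √2)
    (f := fun a => r * a / √(1 - a ^ 2 * s))
    (f' := fun a => r / ((1 - a ^ 2 * s) * √(1 - a ^ 2 * s)))
    (g := fun t => (1 - t ^ 2 / s) / ((2 - s + t ^ 2) * √(2 - s + t ^ 2))) ?_ ?_ ?_
  · have e1 : r * (1 / √2) / √(1 - (1 / √2) ^ 2 * s) = √s := by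
      rw [eq_comm, Real.sqrt_eq_iff_mul_self_eq hw.le (by positivity)]
      rw [← sq, div_pow, mul_pow, h2, hr2, Real.sq_sqrt (by linarith)]
      field_simp
    have e2 : r * (-(1 / √2)) / √(1 - (-(1 / √2)) ^ 2 * s) = -√s := by
      rw [neg_sq, mul_neg, neg_div, e1]
    simp only [e1, e2] at key
    rw [← key]
    apply intervalIntegral.integral_congr
    intro a haa
    have hp := ha a haa
    have hq : 1 - a ^ 2 + a ^ 2 * w ^ 2 = 1 - a ^ 2 * s := by rw [hs]; ring
    simp only [Function.comp, hq]
    set q := √(1 - a ^ 2 * s) with hqq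
    have hqp : 0 < q := Real.sqrt_pos.2 hp
    have hq2 : 1 - a ^ 2 * s = q ^ 2 := (Real.sq_sqrt hp.le).symm
    have e3 : 2 - s + (r * a / q) ^ 2 = (√(2 - s) / q) ^ 2 := by
      rw [div_pow, mul_pow, hr2, div_pow, Real.sq_sqrt hb0.le]
      field_simp
      rw [← hq2]; ring
    rw [e3, Real.sqrt_sq (by positivity), hq2]
    have e4 : r = √(2 - s) * √s := Real.sqrt_mul hb0.le s
    have e5 : (√(2 - s)) ^ 2 = 2 - s := Real.sq_sqrt hb0.le
    have e6 : (√s) ^ 2 = s := Real.sq_sqrt hw.le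
    have hm : 0 < √(2 - s) := Real.sqrt_pos.2 hb0
    rw [e4]
    set m := √(2 - s)
    set n := √s
    have hn : 0 < n := Real.sqrt_pos.2 hw
    rw [← e5]
    have e7 : s = n ^ 2 := e6.symm
    rw [e7] 
    field_simp
  · intro a haa
    have hp := ha a haa
    have d1 : HasDerivAt (fun a : ℝ => 1 - a ^ 2 * s) (-(2 * a * s)) a := by
      simpa using ((hasDerivAt_pow 2 a).mul_const s).const_sub 1
    have d2 := ((hasDerivAt_id a).const_mul r).div (d1.sqrt hp.ne') (Real.sqrt_pos.2 hp).ne'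
    refine d2.congr_deriv ?_
    simp only [id]
    set q := √(1 - a ^ 2 * s) with hqq
    have hqp : 0 < q := Real.sqrt_pos.2 hp
    have hq2 : q ^ 2 = 1 - a ^ 2 * s := (Real.sq_sqrt hp.le)
    rw [← hq2]
    field_simp
    rw [hq2]; ring
  · apply ContinuousOn.div continuousOn_const (by fun_prop)
    intro a haa
    have hp := ha a haa
    have := Real.sqrt_pos.2 hp
    positivity
  · have : ∀ t : ℝ, ((2 - s + t ^ 2) * √(2 - s + t ^ 2)) ≠ 0 := by
      intro t
      have : 0 < 2 - s + t ^ 2 := by positivity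
      have := Real.sqrt_pos.2 this
      positivity
    fun_prop (disch := assumption)

lemma an_int3 : ∫ a in (-(1 / √2 : ℝ))..(1 / √2), (√2 - 1 / √(1 - a ^ 2)) = 2 - Real.pi / 2 := by
  have h2 : (1 / √2 : ℝ) ^ 2 = 1 / 2 := by
    rw [div_pow, Real.sq_sqrt (by norm_num)]; norm_num
  have h2p : 0 < (1 / √2 : ℝ) := by positivity
  have ha : ∀ a ∈ Set.uIcc (-(1 / √2)) (1 / √2 : ℝ), 0 < 1 - a ^ 2 := by
    intro a ha
    rw [Set.uIcc_of_le (by linarith)] at ha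
    have : a ^ 2 ≤ (1 / √2) ^ 2 := sq_le_sq' ha.1 ha.2
    rw [h2] at this
    linarith
  rw [intervalIntegral.integral_eq_sub_of_hasDerivAt (f := fun a => √2 * a - Real.arcsin a)]
  · have : Real.arcsin (1 / √2) = Real.pi / 4 := by
      rw [Real.arcsin_eq_iff_eq_sin, Real.sin_pi_div_four]
      · rw [div_eq_div_iff (by positivity) (by norm_num)]
        norm_num
      · constructor <;> linarith [Real.pi_pos]
    have e : √2 * (1 / √2) = 1 := by field_simp
    rw [Real.arcsin_neg, this, mul_neg, e]
    ring
  · intro a haa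
    have hp := ha a haa
    have : |a| < 1 := (sq_lt_one_iff_abs_lt_one _).1 (by linarith)
    rw [abs_lt] at this
    simpa using! ((hasDerivAt_id a).const_mul (√2)).sub (Real.hasDerivAt_arcsin this.1.ne' this.2.ne)
  · apply ContinuousOn.intervalIntegrable
    apply ContinuousOn.sub continuousOn_const
    apply ContinuousOn.div continuousOn_const (by fun_prop)
    intro a haa
    exact (Real.sqrt_pos.2 (ha a haa)).ne'

lemma an_lint {f : ℝ → ℝ} {a b : ℝ} (hab : a ≤ b) (hf : IntervalIntegrable f volume a b)
    (h0 : ∀ x ∈ Set.Ioc a b, 0 ≤ f x) :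
    ∫⁻ x in Set.Ioc a b, ENNReal.ofReal (f x) = ENNReal.ofReal (∫ x in a..b, f x) := by
  rw [intervalIntegral.integral_of_le hab, ofReal_integral_eq_lintegral_ofReal]
  · exact (intervalIntegrable_iff_integrableOn_Ioc_of_le hab).1 hf
  · exact (ae_restrict_iff' measurableSet_Ioc).2 (Filter.Eventually.of_forall h0)

/-- the scaled integrand -/
noncomputable def anK (w t : ℝ) : ENNReal :=
  if w ^ 2 < 1 then
    ENNReal.ofReal ((1 - t ^ 2 / (1 - w ^ 2)) / ((1 + w ^ 2 + t ^ 2) * √(1 + w ^ 2 + t ^ 2))) else 0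

lemma an_inner (w : ℝ) (hw : 0 < 1 - w ^ 2) :
    ∫⁻ t, anK w t = ∫⁻ a in Set.Ioc (-(1 / √2)) (1 / √2 : ℝ), ENNReal.ofReal
      (√(1 - w ^ 2) * (1 / (1 + w ^ 2) - a ^ 2 / (1 - a ^ 2 + a ^ 2 * w ^ 2))) := by
  have h2 : (1 / √2 : ℝ) ^ 2 = 1 / 2 := by
    rw [div_pow, Real.sq_sqrt (by norm_num)]; norm_num
  have h2p : 0 < (1 / √2 : ℝ) := by positivity
  have hd : ∀ t : ℝ, 0 < (1 + w ^ 2 + t ^ 2) * √(1 + w ^ 2 + t ^ 2) := by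
    intro t
    have : 0 < 1 + w ^ 2 + t ^ 2 := by positivity
    have := Real.sqrt_pos.2 this
    positivity
  have ha : ∀ a ∈ Set.Icc (-(1 / √2)) (1 / √2 : ℝ), a ^ 2 ≤ 1 / 2 := by
    intro a ha
    have : a ^ 2 ≤ (1 / √2) ^ 2 := sq_le_sq' ha.1 ha.2
    rwa [h2] at this
  have hden : ∀ a ∈ Set.Icc (-(1 / √2)) (1 / √2 : ℝ), 0 < 1 - a ^ 2 + a ^ 2 * w ^ 2 := by
    intro a haa
    have := ha a haa
    nlinarith [mul_nonneg (sq_nonneg a) (sq_nonneg w)]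
  rw [an_lint (by linarith), ← an_int2 w hw, ← an_lint]
  · rw [← lintegral_indicator measurableSet_Ioc]
    apply lintegral_congr
    intro t
    rw [anK, if_pos (by linarith)]
    by_cases ht : t ∈ Set.Ioc (-√(1 - w ^ 2)) (√(1 - w ^ 2))
    · rw [Set.indicator_of_mem ht]
    · rw [Set.indicator_of_notMem ht]
      apply ENNReal.ofReal_of_nonpos
      apply div_nonpos_of_nonpos_of_nonneg _ (hd t).le
      have : 1 - w ^ 2 ≤ t ^ 2 := by
        by_contra! hc
        apply ht
        have := Real.sq_lt.1 hc
        exact ⟨this.1, this.2.le⟩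
      have : 1 ≤ t ^ 2 / (1 - w ^ 2) := by rwa [one_le_div hw]
      linarith
  · linarith [Real.sqrt_nonneg (1 - w ^ 2)]
  · apply Continuous.intervalIntegrable
    have : ∀ t : ℝ, (1 + w ^ 2 + t ^ 2) * √(1 + w ^ 2 + t ^ 2) ≠ 0 := fun t => (hd t).ne'
    fun_prop (disch := assumption)
  · intro t ht
    apply div_nonneg _ (hd t).le
    have h1 : t ^ 2 ≤ (√(1 - w ^ 2)) ^ 2 := sq_le_sq' ht.1.le ht.2
    rw [Real.sq_sqrt hw.le] at h1
    have : t ^ 2 / (1 - w ^ 2) ≤ 1 := by rwa [div_le_one hw]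
    linarith
  · apply ContinuousOn.intervalIntegrable
    rw [Set.uIcc_of_le (by linarith)]
    apply ContinuousOn.mul continuousOn_const
    apply ContinuousOn.sub continuousOn_const
    apply ContinuousOn.div (by fun_prop) (by fun_prop)
    intro a haa
    exact (hden a haa).ne'
  · intro a haa
    have haa := Set.Ioc_subset_Icc_self haa
    apply mul_nonneg (Real.sqrt_nonneg _)
    rw [sub_nonneg, div_le_div_iff₀ (hden a haa) (by positivity)]
    nlinarith [ha a haa]

lemma an_main : ∫⁻ w, ∫⁻ t, anK w t = ENNReal.ofReal (2 * Real.pi * (1 - Real.pi / 4)) := by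
  have h2 : (1 / √2 : ℝ) ^ 2 = 1 / 2 := by
    rw [div_pow, Real.sq_sqrt (by norm_num)]; norm_num
  have h2p : 0 < (1 / √2 : ℝ) := by positivity
  have ha : ∀ a ∈ Set.Icc (-(1 / √2)) (1 / √2 : ℝ), a ^ 2 ≤ 1 / 2 := by
    intro a ha
    have : a ^ 2 ≤ (1 / √2) ^ 2 := sq_le_sq' ha.1 ha.2
    rwa [h2] at this
  have s1 : ∫⁻ w, ∫⁻ t, anK w t = ∫⁻ w in Set.Ioc (-1 : ℝ) 1,
      ∫⁻ a in Set.Ioc (-(1 / √2)) (1 / √2 : ℝ), ENNReal.ofReal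
      (√(1 - w ^ 2) * (1 / (1 + w ^ 2) - a ^ 2 / (1 - a ^ 2 + a ^ 2 * w ^ 2))) := by
    rw [← lintegral_indicator measurableSet_Ioc]
    apply lintegral_congr
    intro w
    by_cases hw : w ^ 2 < 1
    · rw [an_inner w (by linarith), Set.indicator_of_mem]
      have := abs_lt.1 ((sq_lt_one_iff_abs_lt_one _).1 hw)
      exact ⟨this.1, this.2.le⟩
    · have : ∀ t, anK w t = 0 := fun t => if_neg hw
      simp only [this, lintegral_zero]
      symm
      rw [Set.indicator_apply_eq_zero]
      intro _
      have h0 : √(1 - w ^ 2) = 0 := Real.sqrt_eq_zero_of_nonpos (by linarith)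
      rw [h0]
      simp
  rw [s1, lintegral_lintegral_swap]
  swap
  · apply Measurable.aemeasurable
    unfold Function.uncurry
    fun_prop
  have s2 : ∀ a ∈ Set.Ioc (-(1 / √2)) (1 / √2 : ℝ), ∫⁻ w in Set.Ioc (-1 : ℝ) 1, ENNReal.ofReal
      (√(1 - w ^ 2) * (1 / (1 + w ^ 2) - a ^ 2 / (1 - a ^ 2 + a ^ 2 * w ^ 2)))
      = ENNReal.ofReal (Real.pi * (√2 - 1 / √(1 - a ^ 2))) := by
    intro a haa
    have ha1 := ha a (Set.Ioc_subset_Icc_self haa)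
    have hden : ∀ w : ℝ, 0 < 1 - a ^ 2 + a ^ 2 * w ^ 2 := by
      intro w
      nlinarith [mul_nonneg (sq_nonneg a) (sq_nonneg w)]
    have hden2 : ∀ A : ℝ, 0 ≤ A → A < 1 → ∀ w : ℝ, 1 - A + A * w ^ 2 ≠ 0 := by
      intro A h0 h1 w
      have := mul_nonneg h0 (sq_nonneg w)
      linarith
    have hii : ∀ A : ℝ, 0 ≤ A → A < 1 → IntervalIntegrable
        (fun w : ℝ => A * √(1 - w ^ 2) / (1 - A + A * w ^ 2)) volume (-1) 1 := by
      intro A h0 h1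
      apply Continuous.intervalIntegrable
      have := hden2 A h0 h1
      fun_prop (disch := assumption)
    have heq : (fun w : ℝ => √(1 - w ^ 2) * (1 / (1 + w ^ 2) - a ^ 2 / (1 - a ^ 2 + a ^ 2 * w ^ 2))) =
        fun w => (1 / 2) * √(1 - w ^ 2) / (1 - 1 / 2 + (1 / 2) * w ^ 2) -
          a ^ 2 * √(1 - w ^ 2) / (1 - a ^ 2 + a ^ 2 * w ^ 2) := by
      funext w
      have h3 : (1 - 1 / 2 + (1 / 2) * w ^ 2) = (1 / 2) * (1 + w ^ 2) := by ring
      rw [h3]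
      have := (hden w).ne'
      field_simp
    rw [an_lint (by norm_num)]
    · rw [heq, intervalIntegral.integral_sub (hii _ (by norm_num) (by norm_num))
        (hii _ (sq_nonneg a) (by linarith)), an_int1 _ (by norm_num) (by norm_num),
        an_int1 _ (sq_nonneg a) (by linarith)]
      congr 1
      have : 1 / √(1 - 1 / 2 : ℝ) = √2 := by
        rw [show (1 - 1 / 2 : ℝ) = 1 / 2 by norm_num, Real.sqrt_div (by norm_num)]
        simp
      rw [this]; ring
    · rw [heq]
      exact (hii _ (by norm_num) (by norm_num)).sub (hii _ (sq_nonneg a) (by linarith))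
    · intro w _
      apply mul_nonneg (Real.sqrt_nonneg _)
      rw [sub_nonneg, div_le_div_iff₀ (hden w) (by positivity)]
      nlinarith
  rw [setLIntegral_congr_fun measurableSet_Ioc s2, an_lint (by linarith)]
  · rw [intervalIntegral.integral_const_mul, an_int3]
    congr 1; ring
  · apply ContinuousOn.intervalIntegrable
    rw [Set.uIcc_of_le (by linarith)]
    apply ContinuousOn.mul continuousOn_const
    apply ContinuousOn.sub continuousOn_const
    apply ContinuousOn.div continuousOn_const (by fun_prop)
    intro a haa
    have := ha a haa
    exact (Real.sqrt_pos.2 (by linarith)).ne'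
  · intro a haa
    have := ha a (Set.Ioc_subset_Icc_self haa)
    apply mul_nonneg Real.pi_pos.le
    rw [sub_nonneg, one_div, inv_le_comm₀ (Real.sqrt_pos.2 (by linarith)) (by positivity)]
    rw [← Real.sqrt_inv]
    apply Real.sqrt_le_sqrt
    norm_num
    linarith


/-- standard Gaussian on the line -/
noncomputable abbrev gsG : Measure ℝ := gaussianReal 0 1
/-- standard Gaussian on the plane -/
noncomputable abbrev gsG2 : Measure (ℝ × ℝ) := gsG.prod gsG
/-- standard Gaussian on four-space -/
noncomputable abbrev gsG4 : Measure ((ℝ × ℝ) × (ℝ × ℝ)) := gsG2.prod gsG2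

/-- density -/
noncomputable abbrev gsphi (x : ℝ) : ℝ := (√(2 * Real.pi))⁻¹ * Real.exp (-(x ^ 2 / 2))

lemma gs_eq : gsG = volume.withDensity (fun x => ENNReal.ofReal (gsphi x)) := by
  rw [gsG, gaussianReal_of_var_ne_zero _ one_ne_zero]
  congr 1
  funext x
  rw [gaussianPDF, gaussianPDFReal]
  simp [gsphi, neg_div]

lemma gs_lint (f : ℝ → ENNReal) : ∫⁻ x, f x ∂gsG = ∫⁻ x, ENNReal.ofReal (gsphi x) * f x := by
  rw [gs_eq, lintegral_withDensity_eq_lintegral_mul_non_measurable _ (by fun_prop)]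
  · rfl
  · exact Filter.Eventually.of_forall fun x => ENNReal.ofReal_lt_top

lemma gs_scale (f : ℝ → ENNReal) (x : ℝ) (hx : x ≠ 0) :
    ∫⁻ y, f y ∂gsG = ∫⁻ w, ENNReal.ofReal (|x| * gsphi (x * w)) * f (x * w) := by
  rw [gs_lint]
  conv_lhs => rw [← Real.smul_map_volume_mul_left hx]
  have he : MeasurableEmbedding (fun y : ℝ => x * y) :=
    (Homeomorph.mulLeft₀ x hx).toMeasurableEquiv.measurableEmbedding
  rw [lintegral_smul_measure, he.lintegral_map, smul_eq_mul,
    ← lintegral_const_mul' _ _ (by simp)]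
  apply lintegral_congr
  intro w
  rw [ENNReal.ofReal_mul (abs_nonneg x), mul_assoc]

lemma gs_radial (F : ℝ → ENNReal) (hF : Measurable F) :
    ∫⁻ p, F (p.1 ^ 2 + p.2 ^ 2) ∂gsG2 =
      ∫⁻ r in Set.Ioi (0 : ℝ), ENNReal.ofReal (r * Real.exp (-(r ^ 2 / 2))) * F (r ^ 2) := by
  have h1 : gsG2 = (volume : Measure (ℝ × ℝ)).withDensity
      (fun p => ENNReal.ofReal (gsphi p.1) * ENNReal.ofReal (gsphi p.2)) := by
    rw [gsG2, gs_eq, prod_withDensity (by fun_prop) (by fun_prop)]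
    rfl
  rw [h1, lintegral_withDensity_eq_lintegral_mul _ (by fun_prop) (by fun_prop),
    ← lintegral_comp_polarCoord_symm, polarCoord_target, Measure.volume_eq_prod,
    setLIntegral_prod]
  · apply setLIntegral_congr_fun measurableSet_Ioi
    intro r hr
    have hr : 0 < r := hr
    have : ∀ θ ∈ Set.Ioo (-Real.pi) Real.pi, ENNReal.ofReal ((r, θ) : ℝ × ℝ).1 •
        ((fun p : ℝ × ℝ => ENNReal.ofReal (gsphi p.1) * ENNReal.ofReal (gsphi p.2)) *
          fun p : ℝ × ℝ => F (p.1 ^ 2 + p.2 ^ 2)) (polarCoord.symm (r, θ)) =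
        ENNReal.ofReal ((2 * Real.pi)⁻¹ * (r * Real.exp (-(r ^ 2 / 2)))) * F (r ^ 2) := by
      intro θ _
      have e : (r * Real.cos θ) ^ 2 + (r * Real.sin θ) ^ 2 = r ^ 2 := by
        linear_combination r ^ 2 * Real.cos_sq_add_sin_sq θ
      simp only [polarCoord_symm_apply, Pi.mul_apply, smul_eq_mul, e]
      rw [← mul_assoc, ← ENNReal.ofReal_mul (show 0 ≤ gsphi _ by unfold gsphi; positivity),
        ← ENNReal.ofReal_mul hr.le]
      congr 2
      have h3 : Real.exp (-(r ^ 2 / 2)) =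
          Real.exp (-((r * Real.cos θ) ^ 2 / 2)) * Real.exp (-((r * Real.sin θ) ^ 2 / 2)) := by
        rw [← Real.exp_add, ← e]; congr 1; ring
      have h4 : (2 * Real.pi)⁻¹ = (√(2 * Real.pi))⁻¹ * (√(2 * Real.pi))⁻¹ := by
        rw [← mul_inv, Real.mul_self_sqrt (by positivity)]
      rw [gsphi, gsphi, h3, h4]; ring
    simp only
    rw [setLIntegral_congr_fun measurableSet_Ioo this, setLIntegral_const, Real.volume_Ioo,
      mul_right_comm, ← ENNReal.ofReal_mul (by positivity)]
    congr 2
    field_simp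
    ring
  · apply Measurable.aemeasurable
    have := (continuous_polarCoord_symm).measurable
    fun_prop

lemma gs_exp (c k : ℝ) (hc : 0 ≤ c) (hk : 0 < k) :
    ∫⁻ r in Set.Ioi c, ENNReal.ofReal (r * Real.exp (-(k * r ^ 2 / 2))) =
      ENNReal.ofReal (Real.exp (-(k * c ^ 2 / 2)) / k) := by
  have hd : ∀ x ∈ Set.Ici c, HasDerivAt (fun r => -(Real.exp (-(k * r ^ 2 / 2)) / k))
      (x * Real.exp (-(k * x ^ 2 / 2))) x := by
    intro x _
    have h1 : HasDerivAt (fun r : ℝ => -(k * r ^ 2 / 2)) (-(k * x)) x := by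
      have := (((hasDerivAt_pow 2 x).const_mul k).div_const 2).neg
      refine this.congr_deriv ?_
      simp; ring
    refine ((h1.exp.div_const k).neg).congr_deriv ?_
    field_simp
  have h0 : ∀ x ∈ Set.Ioi c, 0 ≤ x * Real.exp (-(k * x ^ 2 / 2)) := by
    intro x hx
    have : 0 ≤ x := hc.trans (le_of_lt hx)
    positivity
  have ht : Filter.Tendsto (fun r => -(Real.exp (-(k * r ^ 2 / 2)) / k)) Filter.atTop (nhds 0) := by
    have : Filter.Tendsto (fun r : ℝ => k * r ^ 2 / 2) Filter.atTop Filter.atTop :=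
      ((Filter.tendsto_pow_atTop two_ne_zero).const_mul_atTop hk).atTop_div_const two_pos
    have := ((Real.tendsto_exp_neg_atTop_nhds_zero.comp this).div_const k).neg
    simpa [Function.comp_def] using this
  rw [← ofReal_integral_eq_lintegral_ofReal (integrableOn_Ioi_deriv_of_nonneg' hd h0 ht),
    integral_Ioi_of_hasDerivAt_of_nonneg' hd h0 ht]
  · simp
  · exact (ae_restrict_iff' measurableSet_Ioi).2 (Filter.Eventually.of_forall h0)

lemma gs_tail (a : ℝ) (ha : 0 ≤ a) : gsG2 {p | a < p.1 ^ 2 + p.2 ^ 2} =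
    ENNReal.ofReal (Real.exp (-(a / 2))) := by
  have hm : MeasurableSet {p : ℝ × ℝ | a < p.1 ^ 2 + p.2 ^ 2} :=
    measurableSet_lt (by fun_prop) (by fun_prop)
  have := gs_radial ((Set.Ioi a).indicator 1) (measurable_one.indicator measurableSet_Ioi)
  rw [← lintegral_indicator_one hm]
  refine Eq.trans this ?_
  have h2 := gs_exp (√a) 1 (Real.sqrt_nonneg a) one_pos
  simp only [Real.sq_sqrt ha, one_mul, div_one] at h2
  rw [← h2, ← lintegral_indicator measurableSet_Ioi, ← lintegral_indicator measurableSet_Ioi]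
  apply lintegral_congr
  intro r
  by_cases hr : √a < r
  · have hr0 : 0 < r := (Real.sqrt_nonneg a).trans_lt hr
    have : a < r ^ 2 := (Real.sqrt_lt' hr0).1 hr
    simp [Set.indicator, hr, hr0, this]
  · by_cases hr0 : 0 < r
    · have : ¬ a < r ^ 2 := fun h => hr ((Real.sqrt_lt' hr0).2 h)
      simp [Set.indicator, hr, this]
    · simp [Set.indicator, hr, hr0]

lemma gs_ratio (A B : ℝ) (hA : 0 < A) (hB : 0 < B) :
    gsG4 {q | B * (q.2.1 ^ 2 + q.2.2 ^ 2) < A * (q.1.1 ^ 2 + q.1.2 ^ 2)} =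
      ENNReal.ofReal (A / (A + B)) := by
  rw [gsG4, Measure.prod_apply_symm (measurableSet_lt (by fun_prop) (by fun_prop))]
  have : ∀ v : ℝ × ℝ, gsG2 ((fun u => (u, v)) ⁻¹'
      {q : (ℝ × ℝ) × (ℝ × ℝ) | B * (q.2.1 ^ 2 + q.2.2 ^ 2) < A * (q.1.1 ^ 2 + q.1.2 ^ 2)}) =
      ENNReal.ofReal (Real.exp (-(B / A * (v.1 ^ 2 + v.2 ^ 2) / 2))) := by
    intro v
    rw [← gs_tail _ (by positivity)]
    congr 1
    ext u
    simp only [Set.mem_preimage, Set.mem_ofPred_eq]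
    rw [div_mul_eq_mul_div, div_lt_iff₀ hA, mul_comm A]
  simp only [this]
  rw [gs_radial (fun x => ENNReal.ofReal (Real.exp (-(B / A * x / 2)))) (by fun_prop)]
  have h2 := gs_exp 0 (1 + B / A) le_rfl (by positivity)
  have h3 : Real.exp (-((1 + B / A) * 0 ^ 2 / 2)) / (1 + B / A) = A / (A + B) := by
    simp; field_simp
  rw [h3] at h2
  rw [← h2]
  apply setLIntegral_congr_fun measurableSet_Ioi
  intro r hr
  have hr : 0 < r := hr
  simp only
  rw [← ENNReal.ofReal_mul (by positivity), mul_assoc, ← Real.exp_add]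
  congr 3
  ring_nf

lemma gs_H (K g : ℝ) (hg : 0 ≤ g) :
    gsG4 {q | g * ((q.1.1 ^ 2 + q.1.2 ^ 2) + (q.2.1 ^ 2 + q.2.2 ^ 2)) <
      K * ((q.1.1 ^ 2 + q.1.2 ^ 2) - (q.2.1 ^ 2 + q.2.2 ^ 2))} =
      ENNReal.ofReal ((|K| - g) / (2 * |K|)) := by
  by_cases hK : g < |K|
  · rcases lt_abs.1 hK with h | h
    · rw [abs_of_pos (hg.trans_lt h)]
      rw [show (K - g) / (2 * K) = (K - g) / ((K - g) + (K + g)) by ring,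
        ← gs_ratio (K - g) (K + g) (by linarith) (by linarith)]
      congr 1
      ext q
      simp only [Set.mem_ofPred_eq]
      constructor <;> intro h <;> linarith
    · rw [abs_of_neg (by linarith)]
      rw [show (-K - g) / (2 * -K) = (-K - g) / ((-K - g) + (-K + g)) by ring,
        ← gs_ratio (-K - g) (-K + g) (by linarith) (by linarith)]
      have hs : MeasurePreserving Prod.swap gsG4 gsG4 := Measure.measurePreserving_swap
      rw [← hs.measure_preimage (measurableSet_lt (by fun_prop) (by fun_prop)).nullMeasurableSet]
      congr 1
      ext q
      simp only [Set.mem_ofPred_eq, Set.mem_preimage, Prod.fst_swap, Prod.snd_swap]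
      constructor <;> intro h <;> linarith
  · rw [ENNReal.ofReal_of_nonpos]
    · convert measure_empty (μ := gsG4)
      ext q
      simp only [Set.mem_ofPred_eq, Set.mem_empty_iff_false, iff_false, not_lt]
      push Not at hK
      have h1 := (abs_le.1 hK).1
      have h2 := (abs_le.1 hK).2
      have h3 : 0 ≤ q.1.1 ^ 2 + q.1.2 ^ 2 := by positivity
      have h4 : 0 ≤ q.2.1 ^ 2 + q.2.2 ^ 2 := by positivity
      nlinarith
    · apply div_nonpos_of_nonpos_of_nonneg <;> first | positivity | linarith

lemma gs_rot (θ : ℝ) : MeasurePreserving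
    (fun p : ℝ × ℝ => (Real.cos θ * p.1 + Real.sin θ * p.2, -Real.sin θ * p.1 + Real.cos θ * p.2))
    gsG2 gsG2 := by
  refine ⟨by fun_prop, ?_⟩
  refine Eq.trans ?_ (IsGaussian.map_rotation_eq_self_of_forall_strongDual_eq_zero (μ := gsG) ?_ θ)
  · rfl
  · intro L
    rw [integral_continuousLinearMap_gaussianReal]
    simp

lemma gs_comm : MeasurePreserving
    (fun p : (ℝ × ℝ) × (ℝ × ℝ) => ((p.1.1, p.2.1), (p.1.2, p.2.2))) gsG4 gsG4 := by
  have h1 : MeasurePreserving (MeasurableEquiv.prodAssoc : (ℝ × ℝ) × (ℝ × ℝ) ≃ᵐ _)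
    (gsG2.prod gsG2) (gsG.prod (gsG.prod gsG2)) := measurePreserving_prodAssoc gsG gsG gsG2
  have h2 : MeasurePreserving (MeasurableEquiv.prodAssoc : (ℝ × ℝ) × ℝ ≃ᵐ _)
    (gsG2.prod gsG) (gsG.prod gsG2) := measurePreserving_prodAssoc gsG gsG gsG
  have h3 : MeasurePreserving Prod.swap gsG2 gsG2 := Measure.measurePreserving_swap
  have hid := MeasurePreserving.id gsG
  have h4 := hid.prod ((h2.comp (h3.prod hid)).comp (h2.symm _))
  exact ((h1.symm _).comp h4).comp h1


lemma gs_var (c : ℝ) (hc : 0 < c) :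
    ∫⁻ x : ℝ, ENNReal.ofReal (x ^ 2 * Real.exp (-(c * x ^ 2 / 2))) =
      ENNReal.ofReal (√(2 * Real.pi) / (c * √c)) := by
  obtain ⟨v, hv⟩ : ∃ v : NNReal, (v : ℝ) = 1 / c := ⟨⟨1 / c, by positivity⟩, rfl⟩
  have hv0 : v ≠ 0 := by
    intro h
    rw [h] at hv
    have : 0 < 1 / c := by positivity
    simp at hv
    linarith
  have h1 := variance_fun_id_gaussianReal (μ := 0) (v := v)
  have hm : MemLp (fun x : ℝ => x) 2 (gaussianReal 0 v) := memLp_id_gaussianReal' 2 (by simp)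
  have h2 := hm.ofReal_variance_eq
  rw [h1, evariance_eq_lintegral_ofReal] at h2
  simp only [integral_id_gaussianReal, sub_zero] at h2
  rw [gaussianReal_of_var_ne_zero _ hv0,
    lintegral_withDensity_eq_lintegral_mul _ (by fun_prop) (by fun_prop)] at h2
  have h3 : ∀ x : ℝ, ENNReal.ofReal (x ^ 2 * Real.exp (-(c * x ^ 2 / 2))) =
      ENNReal.ofReal (√(2 * Real.pi * v)) *
      ((gaussianPDF 0 v) * fun x => ENNReal.ofReal (x ^ 2)) x := by
    intro x
    simp only [Pi.mul_apply, gaussianPDF, gaussianPDFReal]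
    rw [← ENNReal.ofReal_mul (by positivity), ← ENNReal.ofReal_mul (by positivity)]
    congr 1
    have : √(2 * Real.pi * v) ≠ 0 := by rw [hv]; positivity
    field_simp
    rw [hv]
    congr 2
    field_simp
    ring
  simp only [h3]
  rw [lintegral_const_mul' _ _ ENNReal.ofReal_ne_top, ← h2, ← ENNReal.ofReal_mul (by positivity)]
  congr 1
  have hs : √(2 * Real.pi * (1 / c)) = √(2 * Real.pi) / √c := by
    rw [mul_one_div, Real.sqrt_div (by positivity)]
  rw [hv, hs]
  field_simp

/-- unscaled integrand -/
noncomputable def anF (x y g : ℝ) : ENNReal :=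
  if y ^ 2 < x ^ 2 then ENNReal.ofReal ((x ^ 2 - y ^ 2 - g ^ 2) / (x ^ 2 - y ^ 2)) else 0

lemma anF_meas : Measurable (fun p : ℝ × ℝ × ℝ => anF p.1 p.2.1 p.2.2) := by
  unfold anF
  exact Measurable.ite (measurableSet_lt (by fun_prop) (by fun_prop)) (by fun_prop) (by fun_prop)

lemma anF_scale (x w t : ℝ) (hx : x ≠ 0) : anF x (x * w) (x * t) = anF 1 w t := by
  have hx2 : 0 < x ^ 2 := by positivity
  unfold anF
  have h : (x * w) ^ 2 < x ^ 2 ↔ w ^ 2 < 1 ^ 2 := by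
    rw [mul_pow]
    constructor <;> intro h <;> nlinarith
  simp only [h]
  congr 2
  rw [show x ^ 2 - (x * w) ^ 2 - (x * t) ^ 2 = x ^ 2 * (1 ^ 2 - w ^ 2 - t ^ 2) by ring,
    show x ^ 2 - (x * w) ^ 2 = x ^ 2 * (1 ^ 2 - w ^ 2) by ring, mul_div_mul_left _ _ hx2.ne']

set_option maxHeartbeats 1000000 in
lemma gs_triple : ∫⁻ x, ∫⁻ y, ∫⁻ g, anF x y g ∂gsG ∂gsG ∂gsG = ENNReal.ofReal (1 - Real.pi / 4) := by
  have hm1 : Measurable (fun p : ℝ × ℝ => anF 1 p.1 p.2) :=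
    anF_meas.comp (measurable_const.prodMk measurable_id)
  have s1 : ∫⁻ x, ∫⁻ y, ∫⁻ g, anF x y g ∂gsG ∂gsG ∂gsG =
      ∫⁻ x, ∫⁻ w, ∫⁻ t, ENNReal.ofReal (gsphi x * (|x| * gsphi (x * w)) * (|x| * gsphi (x * t))) *
        anF 1 w t := by
    rw [gs_lint]
    apply lintegral_congr_ae
    filter_upwards [Measure.ae_ne volume (0 : ℝ)] with x hx
    rw [gs_scale _ x hx, ← lintegral_const_mul' _ _ ENNReal.ofReal_ne_top]
    apply lintegral_congr
    intro w
    rw [gs_scale _ x hx, ← mul_assoc, ← ENNReal.ofReal_mul (by unfold gsphi; positivity),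
      ← lintegral_const_mul' _ _ ENNReal.ofReal_ne_top]
    apply lintegral_congr
    intro t
    rw [anF_scale x w t hx, ← mul_assoc, ← ENNReal.ofReal_mul (by unfold gsphi; positivity)]
  have hmm : Measurable (fun p : ℝ × ℝ × ℝ =>
      ENNReal.ofReal (gsphi p.1 * (|p.1| * gsphi (p.1 * p.2.1)) * (|p.1| * gsphi (p.1 * p.2.2))) *
        anF 1 p.2.1 p.2.2) :=
    Measurable.mul (by unfold gsphi; fun_prop) (hm1.comp measurable_snd)
  rw [s1, lintegral_lintegral_swap]
  swap
  · have hq : Measurable (fun q : (ℝ × ℝ) × ℝ =>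
      ENNReal.ofReal (gsphi q.1.1 * (|q.1.1| * gsphi (q.1.1 * q.1.2)) *
        (|q.1.1| * gsphi (q.1.1 * q.2))) * anF 1 q.1.2 q.2) := by
      have hpa : Measurable (fun q : (ℝ × ℝ) × ℝ => ((q.1.2, q.2) : ℝ × ℝ)) := by fun_prop
      exact Measurable.mul (by unfold gsphi; fun_prop) (hm1.comp hpa)
    exact (Measurable.lintegral_prod_right' (ν := volume) hq).aemeasurable
  have s2 : ∀ w, ∫⁻ x, ∫⁻ t,
      ENNReal.ofReal (gsphi x * (|x| * gsphi (x * w)) * (|x| * gsphi (x * t))) * anF 1 w t =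
      ∫⁻ t, ENNReal.ofReal (1 / (2 * Real.pi)) * anK w t := by
    intro w
    rw [lintegral_lintegral_swap]
    swap
    · apply Measurable.aemeasurable
      exact hmm.comp (f := fun p : ℝ × ℝ => (p.1, w, p.2)) (by fun_prop)
    apply lintegral_congr
    intro t
    rw [lintegral_mul_const'']
    swap
    · apply Measurable.aemeasurable
      unfold gsphi; fun_prop
    have hc : 0 < 1 + w ^ 2 + t ^ 2 := by positivity
    have e1 : ∀ x : ℝ, ENNReal.ofReal (gsphi x * (|x| * gsphi (x * w)) * (|x| * gsphi (x * t))) =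
        ENNReal.ofReal ((√(2 * Real.pi))⁻¹ ^ 3) *
          ENNReal.ofReal (x ^ 2 * Real.exp (-((1 + w ^ 2 + t ^ 2) * x ^ 2 / 2))) := by
      intro x
      rw [← ENNReal.ofReal_mul (by positivity)]
      congr 1
      have : Real.exp (-((1 + w ^ 2 + t ^ 2) * x ^ 2 / 2)) =
        Real.exp (-(x ^ 2 / 2)) * Real.exp (-((x * w) ^ 2 / 2)) * Real.exp (-((x * t) ^ 2 / 2)) := by
        rw [← Real.exp_add, ← Real.exp_add]; congr 1; ring
      rw [this, ← sq_abs x]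
      unfold gsphi
      rw [← sq_abs x]
      ring
    simp only [e1]
    rw [lintegral_const_mul' _ _ ENNReal.ofReal_ne_top, gs_var _ hc, ← ENNReal.ofReal_mul (by positivity)]
    unfold anF anK
    by_cases hw : w ^ 2 < 1
    · have hw' : 0 < 1 - w ^ 2 := by linarith
      rw [if_pos (by simpa using hw), if_pos hw, ← ENNReal.ofReal_mul (by positivity),
        ← ENNReal.ofReal_mul (by positivity)]
      congr 1
      have h2 : 1 / (2 * Real.pi) = (√(2 * Real.pi))⁻¹ ^ 2 := by
        rw [inv_pow, Real.sq_sqrt (by positivity)]; ring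
      have h3 : 0 < √(2 * Real.pi) := by positivity
      have h4 : 0 < √(1 + w ^ 2 + t ^ 2) := Real.sqrt_pos.2 hc
      rw [h2]
      generalize √(2 * Real.pi) = q at *
      generalize √(1 + w ^ 2 + t ^ 2) = r at *
      simp only [one_pow]
      field_simp
    · rw [if_neg (by simpa using hw), if_neg hw]
      simp
  simp only [s2]
  have s3 : ∀ w, ∫⁻ t, ENNReal.ofReal (1 / (2 * Real.pi)) * anK w t =
      ENNReal.ofReal (1 / (2 * Real.pi)) * ∫⁻ t, anK w t :=
    fun w => lintegral_const_mul' _ _ ENNReal.ofReal_ne_top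
  simp only [s3]
  rw [lintegral_const_mul' _ _ ENNReal.ofReal_ne_top, an_main, ← ENNReal.ofReal_mul (by positivity)]
  congr 1
  field_simp

/-- integral of the conditional probability -/
lemma gs_final : ∫⁻ q, ENNReal.ofReal ((|q.2.1 ^ 2 - q.2.2 ^ 2| - q.1.1 ^ 2) /
    (2 * |q.2.1 ^ 2 - q.2.2 ^ 2|)) ∂gsG4 = ENNReal.ofReal (1 - Real.pi / 4) := by
  -- the half integrand
  let h : (ℝ × ℝ) × (ℝ × ℝ) → ENNReal := fun q => 2⁻¹ * anF q.2.1 q.2.2 q.1.1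
  have hmeas : Measurable h :=
    (anF_meas.comp (g := fun p : ℝ × ℝ × ℝ => anF p.1 p.2.1 p.2.2)
      (f := fun q : (ℝ × ℝ) × (ℝ × ℝ) => (q.2.1, q.2.2, q.1.1)) (by fun_prop)).const_mul _
  have hsw : MeasurePreserving (Prod.map id Prod.swap) gsG4 gsG4 :=
    (MeasurePreserving.id gsG2).prod Measure.measurePreserving_swap
  have e1 : ∀ q : (ℝ × ℝ) × (ℝ × ℝ), ENNReal.ofReal ((|q.2.1 ^ 2 - q.2.2 ^ 2| - q.1.1 ^ 2) /
      (2 * |q.2.1 ^ 2 - q.2.2 ^ 2|)) = h q + h (Prod.map id Prod.swap q) := by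
    rintro ⟨⟨g, g'⟩, ⟨x, y⟩⟩
    have half : ∀ z : ℝ, (2⁻¹ : ENNReal) * ENNReal.ofReal z = ENNReal.ofReal (z / 2) := by
      intro z
      rw [div_eq_inv_mul, ENNReal.ofReal_mul (by norm_num), ENNReal.ofReal_inv_of_pos two_pos]
      simp
    simp only [h, anF, Prod.map, Prod.swap, id]
    rcases lt_trichotomy (y ^ 2) (x ^ 2) with hlt | heq | hgt
    · rw [if_pos hlt, if_neg hlt.not_gt, abs_of_pos (by linarith), mul_zero, add_zero, half]
      rw [div_div, mul_comm (2 : ℝ)]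
    · simp [heq]
    · rw [if_pos hgt, if_neg hgt.not_gt, abs_of_neg (by linarith), mul_zero, zero_add, half]
      rw [div_div, mul_comm (2 : ℝ), neg_sub]
  simp only [e1]
  rw [lintegral_add_left hmeas, hsw.lintegral_comp hmeas, ← two_mul]
  have e2 : ∫⁻ q, h q ∂gsG4 = 2⁻¹ * ∫⁻ x, ∫⁻ y, ∫⁻ g, anF x y g ∂gsG ∂gsG ∂gsG := by
    rw [gsG4, lintegral_prod_symm _ hmeas.aemeasurable, lintegral_prod]
    · rw [← lintegral_const_mul' _ _ (by simp)]
      apply lintegral_congr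
      intro x
      rw [← lintegral_const_mul' _ _ (by simp)]
      apply lintegral_congr
      intro y
      rw [← lintegral_const_mul' _ _ (by simp), lintegral_prod]
      · simp [h]
      · exact (hmeas.comp (measurable_id.prodMk measurable_const)).aemeasurable
    · exact (hmeas.lintegral_prod_left').aemeasurable
  rw [e2, gs_triple, ← mul_assoc, ENNReal.mul_inv_cancel (by simp) (by simp), one_mul]



/-- The discriminant in rotated coordinates. -/
def dsD (p r : (ℝ × ℝ) × (ℝ × ℝ)) : ℝ :=
  (p.1.1 * r.1.1 + p.1.2 * r.1.2 - p.2.1 * r.2.1 - p.2.2 * r.2.2) ^ 2 -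
    ((p.1.1 ^ 2 + p.1.2 ^ 2) - (p.2.1 ^ 2 + p.2.2 ^ 2)) *
      ((r.1.1 ^ 2 + r.1.2 ^ 2) - (r.2.1 ^ 2 + r.2.2 ^ 2))

lemma ds_polar (x y : ℝ) : ∃ ρ θ : ℝ, x = ρ * Real.cos θ ∧ y = ρ * Real.sin θ := by
  refine ⟨‖(⟨x, y⟩ : ℂ)‖, Complex.arg ⟨x, y⟩, ?_, ?_⟩
  · rw [Complex.norm_mul_cos_arg]
  · rw [Complex.norm_mul_sin_arg]

lemma ds_alg (c s c' s' C S ρ a b r1 r2 t1 t2 : ℝ) (h : c ^ 2 + s ^ 2 = 1)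
    (h' : c' ^ 2 + s' ^ 2 = 1) (H : C ^ 2 + S ^ 2 = 1) (hb : b = ρ * C) (ha : -a = ρ * S) :
    dsD ((a * c, a * s), (b * c', b * s')) ((r1, r2), (t1, t2)) =
      ((a * c) ^ 2 + (a * s) ^ 2 + ((b * c') ^ 2 + (b * s') ^ 2)) *
        (C * (c * r1 + s * r2) + S * (c' * t1 + s' * t2)) ^ 2 -
      (((a * c) ^ 2 + (a * s) ^ 2) - ((b * c') ^ 2 + (b * s') ^ 2)) *
        ((-s * r1 + c * r2) ^ 2 - (-s' * t1 + c' * t2) ^ 2) := by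
  have e1 : (a * c) ^ 2 + (a * s) ^ 2 = a ^ 2 := by linear_combination a ^ 2 * h
  have e2 : (b * c') ^ 2 + (b * s') ^ 2 = b ^ 2 := by linear_combination b ^ 2 * h'
  have e3 : r1 ^ 2 + r2 ^ 2 = (c * r1 + s * r2) ^ 2 + (-s * r1 + c * r2) ^ 2 := by
    linear_combination (-(r1 ^ 2 + r2 ^ 2)) * h
  have e4 : t1 ^ 2 + t2 ^ 2 = (c' * t1 + s' * t2) ^ 2 + (-s' * t1 + c' * t2) ^ 2 := by
    linear_combination (-(t1 ^ 2 + t2 ^ 2)) * h'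
  have e5 : a ^ 2 + b ^ 2 = ρ ^ 2 := by
    have : a ^ 2 = (ρ * S) ^ 2 := by rw [← ha]; ring
    rw [this, hb]; linear_combination ρ ^ 2 * H
  have e6 : a * c * r1 + a * s * r2 - b * c' * t1 - b * s' * t2 =
    a * (c * r1 + s * r2) - b * (c' * t1 + s' * t2) := by ring
  simp only [dsD]
  rw [e1, e2, e3, e4, e5, e6]
  generalize c * r1 + s * r2 = x1
  generalize -s * r1 + c * r2 = x2
  generalize c' * t1 + s' * t2 = y1
  generalize -s' * t1 + c' * t2 = y2
  have e7 : ρ ^ 2 * (C * x1 + S * y1) ^ 2 = (b * x1 - a * y1) ^ 2 := by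
    have : b * x1 - a * y1 = ρ * (C * x1 + S * y1) := by
      linear_combination x1 * hb + y1 * ha
    rw [this]; ring
  rw [e7]; ring

lemma ds_cond (p : (ℝ × ℝ) × (ℝ × ℝ)) :
    gsG4 {r | dsD p r < 0} =
    gsG4 {q | ((p.1.1 ^ 2 + p.1.2 ^ 2) + (p.2.1 ^ 2 + p.2.2 ^ 2)) * q.1.1 ^ 2 <
      ((p.1.1 ^ 2 + p.1.2 ^ 2) - (p.2.1 ^ 2 + p.2.2 ^ 2)) * (q.2.1 ^ 2 - q.2.2 ^ 2)} := by
  obtain ⟨⟨u1, u2⟩, ⟨v1, v2⟩⟩ := p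
  obtain ⟨a, θ, rfl, rfl⟩ := ds_polar u1 u2
  obtain ⟨b, η, rfl, rfl⟩ := ds_polar v1 v2
  obtain ⟨ρ, ζ, hb, ha⟩ := ds_polar b (-a)
  have hF := (((gs_rot ζ).prod (MeasurePreserving.id gsG2)).comp gs_comm).comp
    ((gs_rot θ).prod (gs_rot η))
  symm
  rw [← hF.measure_preimage
    (measurableSet_lt (by fun_prop) (by fun_prop)).nullMeasurableSet]
  congr 1
  ext ⟨⟨r1, r2⟩, ⟨t1, t2⟩⟩
  have := ds_alg (Real.cos θ) (Real.sin θ) (Real.cos η) (Real.sin η) (Real.cos ζ) (Real.sin ζ)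
    ρ a b r1 r2 t1 t2 (Real.cos_sq_add_sin_sq θ) (Real.cos_sq_add_sin_sq η)
    (Real.cos_sq_add_sin_sq ζ) hb ha
  simp only [Set.mem_ofPred_eq, Set.mem_preimage, Function.comp, Prod.map, id]
  rw [this, sub_neg]

lemma ds_meas : Measurable (fun z : ((ℝ × ℝ) × (ℝ × ℝ)) × ((ℝ × ℝ) × (ℝ × ℝ)) => dsD z.1 z.2) := by
  unfold dsD; fun_prop

lemma ds_prob : (gsG4.prod gsG4) {z | dsD z.1 z.2 < 0} = ENNReal.ofReal (1 - Real.pi / 4) := by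
  have hs : MeasurableSet {z : ((ℝ × ℝ) × (ℝ × ℝ)) × ((ℝ × ℝ) × (ℝ × ℝ)) | dsD z.1 z.2 < 0} :=
    measurableSet_lt ds_meas measurable_const
  let s' : Set (((ℝ × ℝ) × (ℝ × ℝ)) × ((ℝ × ℝ) × (ℝ × ℝ))) :=
    {z | ((z.1.1.1 ^ 2 + z.1.1.2 ^ 2) + (z.1.2.1 ^ 2 + z.1.2.2 ^ 2)) * z.2.1.1 ^ 2 <
      ((z.1.1.1 ^ 2 + z.1.1.2 ^ 2) - (z.1.2.1 ^ 2 + z.1.2.2 ^ 2)) * (z.2.2.1 ^ 2 - z.2.2.2 ^ 2)}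
  have hs' : MeasurableSet s' := measurableSet_lt (by fun_prop) (by fun_prop)
  have h1 : (gsG4.prod gsG4) {z | dsD z.1 z.2 < 0} = (gsG4.prod gsG4) s' := by
    rw [Measure.prod_apply hs, Measure.prod_apply hs']
    exact lintegral_congr fun p => ds_cond p
  rw [h1, Measure.prod_apply_symm hs', ← gs_final]
  apply lintegral_congr
  intro q
  rw [← gs_H _ _ (sq_nonneg q.1.1)]
  congr 1
  ext p
  simp only [s', Set.mem_ofPred_eq, Set.mem_preimage]
  rw [mul_comm, mul_comm (p.1.1 ^ 2 + p.1.2 ^ 2 - _)]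

/-- linear change of coordinates -/
lemma ds_T : MeasurePreserving (fun p : (ℝ × ℝ) × (ℝ × ℝ) =>
    (((Real.cos (Real.pi / 4) * p.1.1 + Real.sin (Real.pi / 4) * p.1.2,
      Real.cos (-(Real.pi / 4)) * p.2.1 + Real.sin (-(Real.pi / 4)) * p.2.2),
     (-Real.sin (Real.pi / 4) * p.1.1 + Real.cos (Real.pi / 4) * p.1.2,
      -Real.sin (-(Real.pi / 4)) * p.2.1 + Real.cos (-(Real.pi / 4)) * p.2.2)) :
      (ℝ × ℝ) × (ℝ × ℝ))) gsG4 gsG4 :=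
  gs_comm.comp ((gs_rot (Real.pi / 4)).prod (gs_rot (-(Real.pi / 4))))

/-- the discriminant in matrix coordinates, `p = ((a, d), (c, b))` -/
def dsM (p r : (ℝ × ℝ) × (ℝ × ℝ)) : ℝ :=
  (p.1.1 * r.1.2 + p.1.2 * r.1.1 - p.2.1 * r.2.2 - p.2.2 * r.2.1) ^ 2 -
    4 * (p.1.1 * p.1.2 - p.2.2 * p.2.1) * (r.1.1 * r.1.2 - r.2.2 * r.2.1)

lemma dsM_meas : Measurable (fun z : ((ℝ × ℝ) × (ℝ × ℝ)) × ((ℝ × ℝ) × (ℝ × ℝ)) => dsM z.1 z.2) := by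
  unfold dsM; fun_prop

lemma dsM_prob : (gsG4.prod gsG4) {z | dsM z.1 z.2 < 0} = ENNReal.ofReal (1 - Real.pi / 4) := by
  rw [← ds_prob, ← (ds_T.prod ds_T).measure_preimage
    (measurableSet_lt ds_meas measurable_const).nullMeasurableSet]
  congr 1
  ext ⟨⟨⟨a, d⟩, ⟨c, b⟩⟩, ⟨⟨a', d'⟩, ⟨c', b'⟩⟩⟩
  simp only [Set.mem_ofPred_eq, Set.mem_preimage, Prod.map, dsM, dsD, Real.cos_neg, Real.sin_neg,
    Real.cos_pi_div_four, Real.sin_pi_div_four]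
  have h2 : (√2 / 2) ^ 2 = 1 / 2 := by
    rw [div_pow, Real.sq_sqrt (by norm_num)]; norm_num
  generalize √2 / 2 = k at *
  have e1 : (k * a + k * d) * (k * a' + k * d') + (k * c + -k * b) * (k * c' + -k * b') -
      (-k * a + k * d) * (-k * a' + k * d') - (- -k * c + k * b) * (- -k * c' + k * b') =
      a * d' + d * a' - c * b' - b * c' := by
    linear_combination 2 * (a * d' + d * a' - c * b' - b * c') * h2
  have e2 : ∀ a b c d : ℝ, (k * a + k * d) ^ 2 + (k * c + -k * b) ^ 2 -
      ((-k * a + k * d) ^ 2 + (- -k * c + k * b) ^ 2) = 2 * (a * d - b * c) := by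
    intro a b c d
    linear_combination 4 * (a * d - b * c) * h2
  rw [e1, e2, e2]
  ring_nf

/-- entries to samples -/
def dsE (z : ((ℝ × ℝ) × (ℝ × ℝ)) × ((ℝ × ℝ) × (ℝ × ℝ))) : Fin 2 × Fin 2 × Fin 2 → ℝ := fun i =>
  ![![![z.1.1.1, z.1.2.2], ![z.1.2.1, z.1.1.2]], ![![z.2.1.1, z.2.2.2], ![z.2.2.1, z.2.1.2]]]
    i.1 i.2.1 i.2.2

lemma dsE_meas : Measurable dsE := by
  rw [measurable_pi_iff]
  rintro ⟨k, i, j⟩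
  fin_cases k <;> fin_cases i <;> fin_cases j <;> simp [dsE] <;> fun_prop

lemma dsE_map : (gsG4.prod gsG4).map dsE =
    Measure.pi fun _ : Fin 2 × Fin 2 × Fin 2 => gaussianReal 0 1 := by
  symm
  apply Measure.pi_eq
  intro s hs
  rw [Measure.map_apply dsE_meas (MeasurableSet.univ_pi hs)]
  have : dsE ⁻¹' (Set.univ.pi s) =
      ((s (0, 0, 0) ×ˢ s (0, 1, 1)) ×ˢ (s (0, 1, 0) ×ˢ s (0, 0, 1))) ×ˢ
      ((s (1, 0, 0) ×ˢ s (1, 1, 1)) ×ˢ (s (1, 1, 0) ×ˢ s (1, 0, 1))) := by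
    ext z
    simp only [Set.mem_preimage, Set.mem_univ_pi, Prod.forall, Fin.forall_fin_two, dsE, Set.mem_prod]
    simp
    tauto
  rw [this]
  simp only [Measure.prod_prod, Fintype.prod_prod_type, Fin.prod_univ_two]
  ring

lemma ds_null : (gsG4.prod gsG4) {z | z.1.1.1 * z.1.1.2 - z.1.2.2 * z.1.2.1 = 0} = 0 := by
  have hA : MeasurableSet {p : (ℝ × ℝ) × (ℝ × ℝ) | p.1.1 * p.1.2 - p.2.2 * p.2.1 = 0} :=
    measurableSet_eq_fun (by fun_prop) (by fun_prop)
  have h1 : gsG4 {p : (ℝ × ℝ) × (ℝ × ℝ) | p.1.1 * p.1.2 - p.2.2 * p.2.1 = 0} = 0 := by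
    rw [Measure.measure_prod_null hA]
    refine Filter.Eventually.of_forall fun x => ?_
    have hB : MeasurableSet (Prod.mk x ⁻¹' {p : (ℝ × ℝ) × (ℝ × ℝ) |
      p.1.1 * p.1.2 - p.2.2 * p.2.1 = 0}) := measurable_prodMk_left hA
    simp only [Pi.zero_apply]
    rw [Measure.measure_prod_null hB]
    have : NullSingletonClass gsG := nullSingletonClass_gaussianReal one_ne_zero
    filter_upwards [Measure.ae_ne gsG (0 : ℝ)] with c hc
    refine measure_mono_null (t := {x.1 * x.2 / c}) ?_ (measure_singleton _)
    intro b hb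
    simp only [Set.mem_preimage, Set.mem_ofPred_eq] at hb
    rw [Set.mem_singleton_iff, eq_div_iff hc]
    linarith
  have h2 : {z : ((ℝ × ℝ) × (ℝ × ℝ)) × ((ℝ × ℝ) × (ℝ × ℝ)) |
      z.1.1.1 * z.1.1.2 - z.1.2.2 * z.1.2.1 = 0} =
      {p : (ℝ × ℝ) × (ℝ × ℝ) | p.1.1 * p.1.2 - p.2.2 * p.2.1 = 0} ×ˢ Set.univ := by
    ext z; simp
  rw [h2, Measure.prod_prod, h1, zero_mul]

lemma ds_set : {y : Fin 2 × Fin 2 × Fin 2 → ℝ | IsUnit (M1 y).det ∧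
      0 ≤ ((M1 y)⁻¹ * M2 y).trace ^ 2 - 4 * ((M1 y)⁻¹ * M2 y).det} =
    {y | y (0, 0, 0) * y (0, 1, 1) - y (0, 0, 1) * y (0, 1, 0) ≠ 0 ∧
      0 ≤ dsM ((y (0, 0, 0), y (0, 1, 1)), (y (0, 1, 0), y (0, 0, 1)))
        ((y (1, 0, 0), y (1, 1, 1)), (y (1, 1, 0), y (1, 0, 1)))} := by
  ext y
  simp only [Set.mem_ofPred_eq]
  have hdet : (M1 y).det = y (0, 0, 0) * y (0, 1, 1) - y (0, 0, 1) * y (0, 1, 0) := by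
    simp [M1, Matrix.det_fin_two]
  rw [hdet, isUnit_iff_ne_zero]
  refine and_congr_right fun h => ?_
  have hd : ((M1 y)⁻¹ * M2 y).trace ^ 2 - 4 * ((M1 y)⁻¹ * M2 y).det =
      dsM ((y (0, 0, 0), y (0, 1, 1)), (y (0, 1, 0), y (0, 0, 1)))
        ((y (1, 0, 0), y (1, 1, 1)), (y (1, 1, 0), y (1, 0, 1))) /
        (y (0, 0, 0) * y (0, 1, 1) - y (0, 0, 1) * y (0, 1, 0)) ^ 2 := by
    have ht : ((M1 y)⁻¹ * M2 y).trace =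
        (y (0, 0, 0) * y (0, 1, 1) - y (0, 0, 1) * y (0, 1, 0))⁻¹ *
        (y (0, 1, 1) * y (1, 0, 0) - y (0, 0, 1) * y (1, 1, 0) +
          (- y (0, 1, 0) * y (1, 0, 1) + y (0, 0, 0) * y (1, 1, 1))) := by
      rw [Matrix.inv_def, hdet, Ring.inverse_eq_inv', Matrix.smul_mul, Matrix.trace_smul, smul_eq_mul]
      congr 1
      simp [M1, M2, Matrix.adjugate_fin_two, Matrix.trace_fin_two, Matrix.vecHead,
        Matrix.vecTail]
      ring
    have hdd : ((M1 y)⁻¹ * M2 y).det =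
        (y (0, 0, 0) * y (0, 1, 1) - y (0, 0, 1) * y (0, 1, 0))⁻¹ *
        (y (1, 0, 0) * y (1, 1, 1) - y (1, 0, 1) * y (1, 1, 0)) := by
      rw [Matrix.det_mul, Matrix.det_nonsing_inv, hdet, Ring.inverse_eq_inv']
      simp [M2, Matrix.det_fin_two]
    rw [ht, hdd, dsM]
    field_simp
    ring
  have hp : 0 < (y (0, 0, 0) * y (0, 1, 1) - y (0, 0, 1) * y (0, 1, 0)) ^ 2 := by positivity
  rw [hd, le_div_iff₀ hp, zero_mul]

/-- For `Y_1, Y_2` random `2×2` matrices with i.i.d. standard normal entries, the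
probability that `Y_1` is invertible and `Y_1⁻¹ Y_2` has only real eigenvalues (i.e. the
discriminant `(tr W)² − 4 det W` is nonnegative) equals `π/4`. -/
theorem stmt13 :
    (Measure.pi fun _ : Fin 2 × Fin 2 × Fin 2 => gaussianReal 0 1)
      {y | IsUnit (M1 y).det ∧
        0 ≤ ((M1 y)⁻¹ * M2 y).trace ^ 2 - 4 * ((M1 y)⁻¹ * M2 y).det}
    = ENNReal.ofReal (Real.pi / 4) := by
  rw [ds_set, ← dsE_map, Measure.map_apply dsE_meas]
  swap
  · refine MeasurableSet.inter ?_ ?_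
    · exact (measurableSet_eq_fun (by fun_prop) measurable_const).compl
    · have hm : Measurable (fun y : Fin 2 × Fin 2 × Fin 2 → ℝ =>
          dsM ((y (0, 0, 0), y (0, 1, 1)), (y (0, 1, 0), y (0, 0, 1)))
            ((y (1, 0, 0), y (1, 1, 1)), (y (1, 1, 0), y (1, 0, 1)))) := by
        unfold dsM; fun_prop
      exact measurableSet_le measurable_const hm
  have h1 : dsE ⁻¹' {y | y (0, 0, 0) * y (0, 1, 1) - y (0, 0, 1) * y (0, 1, 0) ≠ 0 ∧
      0 ≤ dsM ((y (0, 0, 0), y (0, 1, 1)), (y (0, 1, 0), y (0, 0, 1)))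
        ((y (1, 0, 0), y (1, 1, 1)), (y (1, 1, 0), y (1, 0, 1)))} =
      {z | dsM z.1 z.2 < 0}ᶜ \ {z | z.1.1.1 * z.1.1.2 - z.1.2.2 * z.1.2.1 = 0} := by
    ext z
    simp only [Set.mem_preimage, Set.mem_ofPred_eq, Set.mem_sdiff, Set.mem_compl_iff, not_lt]
    exact and_comm
  rw [h1, measure_sdiff_null ds_null,
    prob_compl_eq_one_sub (measurableSet_lt dsM_meas measurable_const), dsM_prob,
    ← ENNReal.ofReal_one, ← ENNReal.ofReal_sub _ (by linarith [Real.pi_le_four])]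
  congr 1
  ring
end

section
/- Let m1, m2 be positive integers with 2·m2 > m1 > m2. For almost every pair (Y_1, Y_2) ∈ (ℝ^{m1×m2})² with respect to the measure under which all 2·m1·m2 entries are i.i.d. standard normal, there exist invertible matrices A ∈ ℝ^{m1×m1} and B ∈ ℝ^{m2×m2} such that A·Y_1·B equals the m1×m2 matrix with I_{m2} on top of an (m1−m2)×m2 zero block, and A·Y_2·B equals the m1×m2 matrix with an (m1−m2)×m2 zero block on top of I_{m2}. -/
open Matrix MeasureTheory ProbabilityTheory

/-- The canonical first data matrix: `I_{m2}` on top of an `(m1−m2) × m2` zero block. -/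
def canon1 (m1 m2 : ℕ) : Matrix (Fin m1) (Fin m2) ℝ :=
  Matrix.of fun i j => if (i : ℕ) = (j : ℕ) then 1 else 0

/-- The canonical second data matrix: an `(m1−m2) × m2` zero block on top of `I_{m2}`. -/
def canon2 (m1 m2 : ℕ) : Matrix (Fin m1) (Fin m2) ℝ :=
  Matrix.of fun i j => if (i : ℕ) = (j : ℕ) + (m1 - m2) then 1 else 0

/-- A nonzero real polynomial in `n` variables is a.e. nonzero for an atomless product measure. -/
theorem ae_eval_ne_zero_fin (μ : Measure ℝ) [IsProbabilityMeasure μ]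
    (hμ : ∀ s : Set ℝ, s.Finite → μ s = 0) (n : ℕ) :
    ∀ p : MvPolynomial (Fin n) ℝ, p ≠ 0 →
      ∀ᵐ y ∂(Measure.pi fun _ : Fin n => μ), MvPolynomial.eval y p ≠ 0 := by
  induction n with
  | zero =>
    intro p hp
    refine Filter.Eventually.of_forall fun y hy => hp ?_
    apply MvPolynomial.funext
    intro x
    rw [Subsingleton.elim x y, hy, map_zero]
  | succ n ih =>
    intro p hp
    have hq : MvPolynomial.finSuccEquiv ℝ n p ≠ 0 := by simpa using hp
    obtain ⟨k, hk⟩ : ∃ k, (MvPolynomial.finSuccEquiv ℝ n p).coeff k ≠ 0 := by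
      by_contra! h
      exact hq (Polynomial.ext (by simpa using h))
    have h1 := ih _ hk
    have hmp := (measurePreserving_piFinSuccAbove (fun _ : Fin (n + 1) => μ) 0)
    have hmeas : MeasurableSet {z : ℝ × (Fin n → ℝ) |
        MvPolynomial.eval (Fin.cons z.1 z.2 : Fin (n + 1) → ℝ) p ≠ 0} := by
      have hc : Continuous fun z : ℝ × (Fin n → ℝ) =>
          MvPolynomial.eval (Fin.cons z.1 z.2 : Fin (n + 1) → ℝ) p := by
        refine (MvPolynomial.continuous_eval p).comp ?_
        refine continuous_pi fun i => ?_
        refine Fin.cases ?_ (fun j => ?_) i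
        · simpa using continuous_fst
        · simp only [Fin.cons_succ]
          fun_prop
      exact (isOpen_ne.preimage hc).measurableSet
    have h2 : ∀ᵐ z ∂(μ.prod (Measure.pi fun _ : Fin n => μ)),
        MvPolynomial.eval (Fin.cons z.1 z.2 : Fin (n + 1) → ℝ) p ≠ 0 := by
      rw [Measure.ae_prod_iff_ae_ae hmeas, Measure.ae_ae_comm hmeas]
      filter_upwards [h1] with y hy
      have hne : Polynomial.map (MvPolynomial.eval y) (MvPolynomial.finSuccEquiv ℝ n p) ≠ 0 := by
        intro h
        apply hy
        have := congrArg (fun q => Polynomial.coeff q k) h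
        simpa using this
      have hfin := hμ _ (Polynomial.finite_setOfPred_isRoot hne)
      rw [ae_iff]
      refine measure_mono_null ?_ hfin
      intro x hx
      simp only [ne_eq, not_not, Set.mem_ofPred_eq] at hx
      rw [MvPolynomial.eval_eq_eval_mv_eval'] at hx
      exact hx
    have h3 := hmp.quasiMeasurePreserving.ae h2
    filter_upwards [h3] with y hy
    convert hy using 3
    ext i
    refine Fin.cases ?_ (fun j => ?_) i <;> simp [MeasurableEquiv.piFinSuccAbove]
    try rfl

theorem ae_eval_ne_zero {ι : Type*} [Fintype ι] (μ : Measure ℝ) [IsProbabilityMeasure μ]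
    (hμ : ∀ s : Set ℝ, s.Finite → μ s = 0) (p : MvPolynomial ι ℝ) (hp : p ≠ 0) :
    ∀ᵐ y ∂(Measure.pi fun _ : ι => μ), MvPolynomial.eval y p ≠ 0 := by
  let e := Fintype.equivFin ι
  have h := ae_eval_ne_zero_fin μ hμ _ (MvPolynomial.rename e p)
    (by simpa using (MvPolynomial.rename_injective e e.injective).ne hp)
  have hmp := measurePreserving_piCongrLeft (fun _ : Fin (Fintype.card ι) => μ) e
  have h3 := hmp.quasiMeasurePreserving.ae h
  filter_upwards [h3] with y hy
  rw [MvPolynomial.eval_rename] at hy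
  convert hy using 3
  ext i
  simp [MeasurableEquiv.coe_piCongrLeft, Equiv.piCongrLeft_apply_apply]

/-- Polynomial solutions of a linear system that has full row rank at one point. -/
theorem exists_poly_solution {σ α β : Type*} [Fintype α] [Fintype β] [DecidableEq β]
    (M : Matrix β α (MvPolynomial σ ℝ)) (c : σ → ℝ)
    (hs : Function.Surjective (M.map (MvPolynomial.eval c)).mulVec)
    (x0 : α → ℝ) (hx0 : (M.map (MvPolynomial.eval c)) *ᵥ x0 = 0) :
    ∃ x : α → MvPolynomial σ ℝ, M *ᵥ x = 0 ∧ ∀ a, MvPolynomial.eval c (x a) = x0 a := by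
  classical
  obtain ⟨N, hN⟩ := Matrix.mulVec_surjective_iff_exists_right_inverse.1 hs
  let N' : Matrix α β (MvPolynomial σ ℝ) := N.map MvPolynomial.C
  let x0' : α → MvPolynomial σ ℝ := fun a => MvPolynomial.C (x0 a)
  have hdet : MvPolynomial.eval c (M * N').det = 1 := by
    have h2 : (MvPolynomial.eval c).mapMatrix (M * N') = 1 := by
      rw [RingHom.mapMatrix_apply, Matrix.map_mul, ← hN]
      congr 1
      ext i j
      simp [N']
    rw [RingHom.map_det, h2, det_one]
  refine ⟨(M * N').det • x0' - N' *ᵥ ((M * N').adjugate *ᵥ (M *ᵥ x0')), ?_, ?_⟩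
  · rw [mulVec_sub, mulVec_smul, mulVec_mulVec _ M N', mulVec_mulVec _ (M * N'), mul_adjugate,
      smul_mulVec, one_mulVec, sub_self]
  · have hz : ∀ b, MvPolynomial.eval c ((M *ᵥ x0') b) = 0 := by
      intro b
      have := congrFun hx0 b
      simpa [mulVec, dotProduct, x0'] using this
    intro a
    have : MvPolynomial.eval c ((N' *ᵥ ((M * N').adjugate *ᵥ (M *ᵥ x0'))) a) = 0 := by
      rw [mulVec, dotProduct, map_sum]
      refine Finset.sum_eq_zero fun i _ => ?_
      rw [map_mul, mulVec, dotProduct, map_sum]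
      rw [Finset.sum_eq_zero, mul_zero]
      intro b _
      rw [map_mul, hz, mul_zero]
    rw [Pi.sub_apply, map_sub, this, sub_zero, Pi.smul_apply, smul_eq_mul, map_mul, hdet, one_mul]
    simp [x0']

def fwd (d : ℕ) (P Q : ℕ → ℕ → ℝ) (i k : ℕ) : ℝ :=
  if 0 < d ∧ d ≤ i then Q i (k - d) + (fwd d P Q (i - d) (k - d) - P (i - d) (k - d))
  else Q i (k - d)
termination_by i
decreasing_by omega

def bwd (d m : ℕ) (P Q : ℕ → ℕ → ℝ) (i k : ℕ) : ℝ :=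
  if 0 < d ∧ i < m then P i k + (bwd d m P Q (i + d) (k + d) - Q (i + d) k)
  else P i k
termination_by m - i
decreasing_by omega

theorem exists_ext_zero (m d : ℕ) (hd : 0 < d) (P Q : ℕ → ℕ → ℝ) :
    ∃ A B : ℕ → ℕ → ℝ, ∀ i j, i < m + d → j < m →
      A i j - (if i < m then B i j else 0) = P i j ∧
      A i (j + d) - (if d ≤ i then B (i - d) j else 0) = Q i j := by
  refine ⟨fun i k => if i ≤ k then fwd d P Q i k else bwd d m P Q i k,
    fun i k => (if i ≤ k then fwd d P Q i k else bwd d m P Q i k) - P i k, ?_⟩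
  intro i j hi hj
  constructor
  · by_cases h : i < m
    · simp [h]
    · have : ¬ i ≤ j := by omega
      simp only [h, this, if_false]
      rw [bwd]
      simp [h]
  · by_cases h : d ≤ i
    · by_cases h2 : i ≤ j + d
      · have h3 : i - d ≤ j := by omega
        simp only [h, h2, h3, if_true]
        rw [fwd]
        simp [h, hd]
      · have h3 : ¬ i - d ≤ j := by omega
        simp only [h, h2, h3, if_true, if_false]
        rw [bwd.eq_1 d m P Q (i - d) j]
        have h4 : i - d < m := by omega
        have h5 : i - d + d = i := by omega
        simp [h4, hd, h5]
    · have h2 : i ≤ j + d := by omega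
      simp only [h, h2, if_true, if_false]
      rw [fwd]
      simp [h]

/-- The pair of canonical matrices. -/
def canonPair (m1 m2 : ℕ) (t : Fin 2) : Matrix (Fin m1) (Fin m2) ℝ :=
  if t = 0 then canon1 m1 m2 else canon2 m1 m2

theorem canonPair_mul_surj {m1 m2 : ℕ} (h1 : m2 < m1)
    (P : Fin 2 → Matrix (Fin m1) (Fin m2) ℝ) :
    ∃ (A : Matrix (Fin m1) (Fin m1) ℝ) (B : Matrix (Fin m2) (Fin m2) ℝ),
      ∀ t, A * canonPair m1 m2 t - canonPair m1 m2 t * B = P t := by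
  obtain ⟨A, B, h⟩ := exists_ext_zero m2 (m1 - m2) (by omega)
    (fun i j => if h : i < m1 ∧ j < m2 then P 0 ⟨i, h.1⟩ ⟨j, h.2⟩ else 0)
    (fun i j => if h : i < m1 ∧ j < m2 then P 1 ⟨i, h.1⟩ ⟨j, h.2⟩ else 0)
  refine ⟨Matrix.of fun i j => A i j, Matrix.of fun i j => B i j, fun t => ?_⟩
  ext i j
  obtain ⟨ha, hb⟩ := h i j (by omega) j.2
  simp only [i.2, j.2, and_self, dite_true] at ha hb
  fin_cases t
  · change ((Matrix.of fun i j : Fin m1 => A i j) * canon1 m1 m2 -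
      canon1 m1 m2 * (Matrix.of fun i j : Fin m2 => B i j)) i j = P 0 i j
    rw [← ha]
    simp only [canon1, Matrix.sub_apply, Matrix.mul_apply, Matrix.of_apply]
    congr 1
    · rw [Finset.sum_eq_single (⟨j, by omega⟩ : Fin m1)]
      · simp
      · intro b _ hb
        have : (b : ℕ) ≠ j := fun h => hb (Fin.ext h)
        simp [this]
      · simp
    · split_ifs with hi
      · rw [Finset.sum_eq_single (⟨i, by omega⟩ : Fin m2)]
        · simp
        · intro b _ hb
          have : (i : ℕ) ≠ b := fun h => hb (Fin.ext h.symm)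
          simp [this]
        · simp
      · refine Finset.sum_eq_zero fun b _ => ?_
        have : (i : ℕ) ≠ b := by omega
        simp [this]
  · change ((Matrix.of fun i j : Fin m1 => A i j) * canon2 m1 m2 -
      canon2 m1 m2 * (Matrix.of fun i j : Fin m2 => B i j)) i j = P 1 i j
    rw [← hb]
    simp only [canon2, Matrix.sub_apply, Matrix.mul_apply, Matrix.of_apply]
    congr 1
    · rw [Finset.sum_eq_single (⟨j + (m1 - m2), by omega⟩ : Fin m1)]
      · simp
      · intro b _ hb
        have : (b : ℕ) ≠ j + (m1 - m2) := fun h => hb (Fin.ext h)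
        simp [this]
      · simp
    · split_ifs with hi
      · rw [Finset.sum_eq_single (⟨i - (m1 - m2), by omega⟩ : Fin m2)]
        · simp [hi]
        · intro b _ hb
          have : (i : ℕ) ≠ b + (m1 - m2) := fun h => hb (Fin.ext (by simp; omega))
          simp [this]
        · simp
      · refine Finset.sum_eq_zero fun b _ => ?_
        have : (i : ℕ) ≠ b + (m1 - m2) := by omega
        simp [this]

/-- The matrix of `(A, B) ↦ (A Y_t - C_t B)_t`. -/
def sysMat {S : Type*} [CommRing S] (m1 m2 : ℕ) (Y : Fin 2 × Fin m1 × Fin m2 → S)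
    (Cn : Fin 2 → Matrix (Fin m1) (Fin m2) S) :
    Matrix (Fin 2 × Fin m1 × Fin m2) ((Fin m1 × Fin m1) ⊕ (Fin m2 × Fin m2)) S :=
  Matrix.of fun b a => match a with
    | Sum.inl a => if a.1 = b.2.1 then Y (b.1, a.2, b.2.2) else 0
    | Sum.inr a => if a.2 = b.2.2 then - Cn b.1 b.2.1 a.1 else 0

theorem sysMat_mulVec {S : Type*} [CommRing S] (m1 m2 : ℕ) (Y : Fin 2 × Fin m1 × Fin m2 → S)
    (Cn : Fin 2 → Matrix (Fin m1) (Fin m2) S)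
    (x : (Fin m1 × Fin m1) ⊕ (Fin m2 × Fin m2) → S) (t : Fin 2) (i : Fin m1) (j : Fin m2) :
    (sysMat m1 m2 Y Cn *ᵥ x) (t, i, j) =
      ((Matrix.of fun i k => x (Sum.inl (i, k))) * (Matrix.of fun k j => Y (t, k, j)) -
        Cn t * (Matrix.of fun k j => x (Sum.inr (k, j)))) i j := by
  simp only [mulVec, dotProduct, Fintype.sum_sum_type, Fintype.sum_prod_type, sysMat,
    Matrix.of_apply, Matrix.sub_apply, Matrix.mul_apply, ite_mul, zero_mul]
  rw [Finset.sum_comm]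
  simp [sub_eq_add_neg, mul_comm]

/-- For `2·m2 > m1 > m2`, almost every pair `(Y_1, Y_2)` of `m1 × m2` matrices with
i.i.d. standard normal entries can be brought to the Kronecker canonical form
`(I_{m2} over 0, 0 over I_{m2})` by invertible matrices `A`, `B`: `A·Y_i·B` is canonical. -/
theorem stmt14 {m1 m2 : ℕ} (h1 : m2 < m1) (h2 : m1 < 2 * m2) :
    ∀ᵐ y : Fin 2 × Fin m1 × Fin m2 → ℝ
        ∂(Measure.pi fun _ => gaussianReal 0 1),
      ∃ (A : Matrix (Fin m1) (Fin m1) ℝ) (B : Matrix (Fin m2) (Fin m2) ℝ),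
        IsUnit A.det ∧ IsUnit B.det ∧
        A * (Matrix.of fun i j => y (0, i, j)) * B = canon1 m1 m2 ∧
        A * (Matrix.of fun i j => y (1, i, j)) * B = canon2 m1 m2 := by
  let M := sysMat m1 m2 (fun b => (MvPolynomial.X b : MvPolynomial _ ℝ))
    (fun t => (canonPair m1 m2 t).map MvPolynomial.C)
  have hM : ∀ y, M.map (MvPolynomial.eval y) = sysMat m1 m2 y (canonPair m1 m2) := by
    intro y
    ext b a
    rcases a with a | a <;> simp only [M, sysMat, Matrix.map_apply, Matrix.of_apply] <;>
      split_ifs <;> simp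
  let c : Fin 2 × Fin m1 × Fin m2 → ℝ := fun b => canonPair m1 m2 b.1 b.2.1 b.2.2
  let x0 : (Fin m1 × Fin m1) ⊕ (Fin m2 × Fin m2) → ℝ :=
    Sum.elim (fun a => (1 : Matrix (Fin m1) (Fin m1) ℝ) a.1 a.2)
      (fun a => (1 : Matrix (Fin m2) (Fin m2) ℝ) a.1 a.2)
  have hs : Function.Surjective (M.map (MvPolynomial.eval c)).mulVec := by
    intro w
    obtain ⟨A, B, hAB⟩ := canonPair_mul_surj h1 (fun t => Matrix.of fun i j => w (t, i, j))
    refine ⟨Sum.elim (fun a => A a.1 a.2) (fun a => B a.1 a.2), ?_⟩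
    rw [hM]
    ext ⟨t, i, j⟩
    rw [sysMat_mulVec]
    exact congrFun (congrFun (hAB t) i) j
  have hx0 : (M.map (MvPolynomial.eval c)) *ᵥ x0 = 0 := by
    rw [hM]
    ext ⟨t, i, j⟩
    rw [sysMat_mulVec]
    change ((1 : Matrix (Fin m1) (Fin m1) ℝ) * canonPair m1 m2 t -
      canonPair m1 m2 t * (1 : Matrix (Fin m2) (Fin m2) ℝ)) i j = 0
    simp
  obtain ⟨x, hx, hxc⟩ := exists_poly_solution M c hs x0 hx0
  let A : Matrix (Fin m1) (Fin m1) (MvPolynomial (Fin 2 × Fin m1 × Fin m2) ℝ) :=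
    Matrix.of fun i k => x (Sum.inl (i, k))
  let B : Matrix (Fin m2) (Fin m2) (MvPolynomial (Fin 2 × Fin m1 × Fin m2) ℝ) :=
    Matrix.of fun i k => x (Sum.inr (i, k))
  have hp : A.det * B.det ≠ 0 := by
    intro h
    have h' := congrArg (MvPolynomial.eval c) h
    rw [map_mul, RingHom.map_det, RingHom.map_det, map_zero] at h'
    have hA : (MvPolynomial.eval c).mapMatrix A = 1 := by
      ext i j
      exact hxc _
    have hB : (MvPolynomial.eval c).mapMatrix B = 1 := by
      ext i j
      exact hxc _
    rw [hA, hB, det_one, det_one] at h'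
    norm_num at h'
  have hμ : ∀ s : Set ℝ, s.Finite → gaussianReal 0 1 s = 0 := by
    intro s hs
    exact gaussianReal_absolutelyContinuous 0 one_ne_zero (hs.measure_zero _)
  filter_upwards [ae_eval_ne_zero (gaussianReal 0 1) hμ _ hp] with y hy
  rw [map_mul, RingHom.map_det, RingHom.map_det] at hy
  set A' := (MvPolynomial.eval y).mapMatrix A with hA'
  set B' := (MvPolynomial.eval y).mapMatrix B with hB'
  have hAu : IsUnit A'.det := (left_ne_zero_of_mul hy).isUnit
  have hBu : IsUnit B'.det := (right_ne_zero_of_mul hy).isUnit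
  have key : ∀ t, A' * (Matrix.of fun i j => y (t, i, j)) = canonPair m1 m2 t * B' := by
    intro t
    have h3 : (sysMat m1 m2 y (canonPair m1 m2)) *ᵥ (fun a => MvPolynomial.eval y (x a)) = 0 := by
      rw [← hM]
      ext b
      have := congrArg (MvPolynomial.eval y) (congrFun hx b)
      simpa [mulVec, dotProduct] using this
    ext i j
    have h4 := congrFun h3 (t, i, j)
    rw [sysMat_mulVec] at h4
    exact sub_eq_zero.1 h4
  refine ⟨A', B'⁻¹, hAu, ?_, ?_, ?_⟩
  · exact isUnit_nonsing_inv_det _ hBu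
  · rw [key 0, Matrix.mul_assoc, mul_nonsing_inv _ hBu, Matrix.mul_one]
    rfl
  · rw [key 1, Matrix.mul_assoc, mul_nonsing_inv _ hBu, Matrix.mul_one]
    rfl
end

section
/- Let m ≥ 2, let Y_1 ∈ ℝ^{(m+1)×m} be I_m stacked on top of a 1×m zero row, and Y_2 ∈ ℝ^{(m+1)×m} be a 1×m zero row stacked on top of I_m, and define g_0(Φ) = m·log det(Y_1 Φ Y_1ᵀ + Y_2 Φ Y_2ᵀ) − (m+1)·log det(Φ) for Φ ∈ PD(m). Then on the set of matrices Φ ∈ PD(m) whose (1,1) entry equals 1, g_0 is uniquely minimized by the diagonal matrix Φ_0 = diag( C(m−1, j−1) : j = 1, …, m ) of binomial coefficients; that is, g_0(Φ) ≥ g_0(Φ_0) for every such Φ, with equality if and only if Φ = Φ_0. -/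
open Matrix

/-- `Y_1 ∈ ℝ^{(m+1)×m}`: `I_m` stacked on top of a zero row. -/
def canonU (m : ℕ) : Matrix (Fin (m + 1)) (Fin m) ℝ :=
  Matrix.of fun i j => if (i : ℕ) = (j : ℕ) then 1 else 0

/-- `Y_2 ∈ ℝ^{(m+1)×m}`: a zero row stacked on top of `I_m`. -/
def canonL (m : ℕ) : Matrix (Fin (m + 1)) (Fin m) ℝ :=
  Matrix.of fun i j => if (i : ℕ) = (j : ℕ) + 1 then 1 else 0

/-- `g_0(Φ) = m·log det(Y_1 Φ Y_1ᵀ + Y_2 Φ Y_2ᵀ) − (m+1)·log det Φ`. -/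
noncomputable def g0 {m : ℕ} (Φ : Matrix (Fin m) (Fin m) ℝ) : ℝ :=
  (m : ℝ) * Real.log (canonU m * Φ * (canonU m)ᵀ + canonL m * Φ * (canonL m)ᵀ).det
    - ((m : ℝ) + 1) * Real.log Φ.det

/-- The binomial-coefficient diagonal matrix `Φ_0 = diag(C(m−1, j−1) : j = 1, …, m)`. -/
noncomputable def Phi0 (m : ℕ) : Matrix (Fin m) (Fin m) ℝ :=
  Matrix.diagonal fun j : Fin m => ((m - 1).choose (j : ℕ) : ℝ)


theorem aux_spectral_s17 {n : Type*} [Fintype n] [DecidableEq n] (X : Matrix n n ℝ)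
    (hX : X.IsHermitian) : ∃ (U : Matrix n n ℝ) (l : n → ℝ), Uᵀ * U = 1 ∧ U * Uᵀ = 1 ∧
      X = U * diagonal l * Uᵀ ∧ l = hX.eigenvalues := by
  refine ⟨(hX.eigenvectorUnitary : Matrix n n ℝ), hX.eigenvalues, ?_, ?_, ?_, rfl⟩
  · have := Unitary.coe_star_mul_self hX.eigenvectorUnitary
    rwa [star_eq_conjTranspose, conjTranspose_eq_transpose_of_trivial] at this
  · have := Unitary.coe_mul_star_self hX.eigenvectorUnitary
    rw [Unitary.coe_star] at this
    rwa [star_eq_conjTranspose, conjTranspose_eq_transpose_of_trivial] at this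
  · have := hX.spectral_theorem
    rw [Unitary.conjStarAlgAut_apply, star_eq_conjTranspose,
      conjTranspose_eq_transpose_of_trivial] at this
    exact this

theorem aux_scalar {x : ℝ} (hx : 0 < x) : 0 ≤ x - 1 - Real.log x := by
  linarith [Real.log_le_sub_one_of_pos hx]

theorem aux_jensen {n k : Type*} [Fintype n] [Fintype k] (q : k → n → ℝ) (l : n → ℝ) (t : k → ℝ)
    (c : ℝ) (hq : ∀ i j, 0 ≤ q i j) (hl : ∀ j, 0 < l j) (hr : ∀ i, ∑ j, q i j = 1)
    (hc : ∀ j, ∑ i, q i j = c) (ht : ∀ i, t i = ∑ j, q i j * l j) :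
    (∀ i, 0 < t i) ∧ c * ∑ j, Real.log (l j) ≤ ∑ i, Real.log (t i) ∧
    (c * ∑ j, Real.log (l j) = ∑ i, Real.log (t i) → ∀ i j, q i j ≠ 0 → l j = t i) := by
  have htp : ∀ i, 0 < t i := by
    intro i
    have h0 : ∀ j ∈ Finset.univ, 0 ≤ q i j * l j := fun j _ => mul_nonneg (hq i j) (hl j).le
    rw [ht]
    refine lt_of_le_of_ne (Finset.sum_nonneg h0) ?_
    intro h
    have h1 := (Finset.sum_eq_zero_iff_of_nonneg h0).1 h.symm
    have h2 : ∑ j, q i j = 0 := Finset.sum_eq_zero fun j hj => by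
      rcases mul_eq_zero.1 (h1 j hj) with h | h
      · exact h
      · exact absurd h (hl j).ne'
    rw [hr] at h2
    exact one_ne_zero h2
  have hterm : ∀ i j, 0 ≤ q i j * (l j / t i - 1 - Real.log (l j / t i)) := fun i j =>
    mul_nonneg (hq i j) (aux_scalar (div_pos (hl j) (htp i)))
  have hrow : ∀ i, ∑ j, q i j * (l j / t i - 1 - Real.log (l j / t i))
      = Real.log (t i) - ∑ j, q i j * Real.log (l j) := by
    intro i
    have : ∀ j, q i j * (l j / t i - 1 - Real.log (l j / t i))
        = (q i j * l j) * (t i)⁻¹ - q i j + q i j * Real.log (t i) - q i j * Real.log (l j) := by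
      intro j
      rw [Real.log_div (hl j).ne' (htp i).ne']
      ring
    simp_rw [this]
    rw [Finset.sum_sub_distrib, Finset.sum_add_distrib, Finset.sum_sub_distrib, ← Finset.sum_mul,
      ← Finset.sum_mul, ← ht, hr, mul_inv_cancel₀ (htp i).ne']
    ring
  have hsum : ∑ i, ∑ j, q i j * (l j / t i - 1 - Real.log (l j / t i))
      = ∑ i, Real.log (t i) - c * ∑ j, Real.log (l j) := by
    simp_rw [hrow]
    rw [Finset.sum_sub_distrib, Finset.sum_comm, Finset.mul_sum]
    simp_rw [← Finset.sum_mul, hc]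
  have hnn : ∀ i ∈ Finset.univ, 0 ≤ ∑ j, q i j * (l j / t i - 1 - Real.log (l j / t i)) :=
    fun i _ => Finset.sum_nonneg fun j _ => hterm i j
  refine ⟨htp, ?_, ?_⟩
  · have := Finset.sum_nonneg hnn
    linarith
  · intro h i j hqij
    rw [h, sub_self] at hsum
    have h1 := (Finset.sum_eq_zero_iff_of_nonneg hnn).1 hsum i (Finset.mem_univ _)
    have h2 := (Finset.sum_eq_zero_iff_of_nonneg fun j _ => hterm i j).1 h1 j (Finset.mem_univ _)
    rcases mul_eq_zero.1 h2 with h | h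
    · exact absurd h hqij
    · by_contra hne
      have h3 := Real.log_lt_sub_one_of_pos (div_pos (hl j) (htp i))
        (fun h => hne ((div_eq_one_iff_eq (htp i).ne').1 h))
      linarith

theorem aux_core {n k : Type*} [Fintype n] [Fintype k] [DecidableEq n] [DecidableEq k]
    (A B : Matrix k n ℝ) (c : ℝ) (h1 : A * Aᵀ + B * Bᵀ = 1) (h2 : Aᵀ * A + Bᵀ * B = c • 1)
    (X : Matrix n n ℝ) (hX : X.PosDef) (T : Matrix k k ℝ) (hT : T = A * X * Aᵀ + B * X * Bᵀ) :
    0 < T.det ∧ c * Real.log X.det ≤ Real.log T.det ∧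
    (c * Real.log X.det = Real.log T.det → X * Aᵀ = Aᵀ * T ∧ X * Bᵀ = Bᵀ * T) := by
  have hXt : Xᵀ = X := by
    have := hX.isHermitian
    rwa [Matrix.IsHermitian, conjTranspose_eq_transpose_of_trivial] at this
  have hTh : T.IsHermitian := by
    rw [Matrix.IsHermitian, conjTranspose_eq_transpose_of_trivial, hT]
    simp [transpose_mul, hXt, Matrix.mul_assoc]
  obtain ⟨U, l, hU1, hU2, hXU, hl⟩ := aux_spectral_s17 X hX.isHermitian
  obtain ⟨V, t, hV1, hV2, hTV, -⟩ := aux_spectral_s17 T hTh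
  have hlp : ∀ j, 0 < l j := by rw [hl]; exact hX.eigenvalues_pos
  have hdetU : U.det * U.det = 1 := by
    have := congrArg det hU1; simpa [det_mul] using this
  have hdetV : V.det * V.det = 1 := by
    have := congrArg det hV1; simpa [det_mul] using this
  have hdX : X.det = ∏ j, l j := by
    rw [hXU, det_mul, det_mul, det_transpose, det_diagonal]
    linear_combination (∏ j, l j) * hdetU
  have hdT : T.det = ∏ j, t j := by
    rw [hTV, det_mul, det_mul, det_transpose, det_diagonal]
    linear_combination (∏ j, t j) * hdetV
  obtain ⟨P, hP⟩ : ∃ P, P = Vᵀ * A * U := ⟨_, rfl⟩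
  obtain ⟨Q, hQ⟩ : ∃ Q, Q = Vᵀ * B * U := ⟨_, rfl⟩
  have hA : A = V * P * Uᵀ := by
    rw [hP]
    calc A = (V * Vᵀ) * A * (U * Uᵀ) := by rw [hV2, hU2]; simp
      _ = _ := by simp only [Matrix.mul_assoc]
  have hB : B = V * Q * Uᵀ := by
    rw [hQ]
    calc B = (V * Vᵀ) * B * (U * Uᵀ) := by rw [hV2, hU2]; simp
      _ = _ := by simp only [Matrix.mul_assoc]
  have k1 : P * Pᵀ + Q * Qᵀ = 1 := by
    calc P * Pᵀ + Q * Qᵀ = Vᵀ * (A * (U * Uᵀ) * Aᵀ + B * (U * Uᵀ) * Bᵀ) * V := by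
          rw [hP, hQ]
          simp only [transpose_mul, transpose_transpose, Matrix.mul_assoc, Matrix.mul_add,
            Matrix.add_mul]
      _ = 1 := by rw [hU2, Matrix.mul_one, Matrix.mul_one, h1, Matrix.mul_one, hV1]
  have k2 : Pᵀ * P + Qᵀ * Q = c • 1 := by
    calc Pᵀ * P + Qᵀ * Q = Uᵀ * (Aᵀ * (V * Vᵀ) * A + Bᵀ * (V * Vᵀ) * B) * U := by
          rw [hP, hQ]
          simp only [transpose_mul, transpose_transpose, Matrix.mul_assoc, Matrix.mul_add,
            Matrix.add_mul]
      _ = _ := by rw [hV2, Matrix.mul_one, Matrix.mul_one, h2]; simp [hU1]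
  have k3 : diagonal t = P * diagonal l * Pᵀ + Q * diagonal l * Qᵀ := by
    calc diagonal t = (Vᵀ * V) * diagonal t * (Vᵀ * V) := by rw [hV1]; simp
      _ = Vᵀ * T * V := by rw [hTV]; simp only [Matrix.mul_assoc]
      _ = _ := by
          rw [hT, hP, hQ, hXU]
          simp only [transpose_mul, transpose_transpose, Matrix.mul_assoc, Matrix.mul_add,
            Matrix.add_mul]
  obtain ⟨htp, hle, heq⟩ := aux_jensen (fun i j => P i j ^ 2 + Q i j ^ 2) l t c
    (fun i j => by positivity) hlp
    (fun i => by
      have := congrFun (congrFun k1 i) i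
      simp only [Matrix.add_apply, Matrix.mul_apply, transpose_apply, one_apply_eq] at this
      rw [← this, ← Finset.sum_add_distrib]
      exact Finset.sum_congr rfl fun j _ => by ring)
    (fun j => by
      have := congrFun (congrFun k2 j) j
      simp only [Matrix.add_apply, Matrix.mul_apply, transpose_apply, Matrix.smul_apply,
        one_apply_eq, smul_eq_mul, mul_one] at this
      rw [← this, ← Finset.sum_add_distrib]
      exact Finset.sum_congr rfl fun j _ => by ring)
    (fun i => by
      have := congrFun (congrFun k3 i) i
      simp only [Matrix.add_apply, mul_diagonal, Matrix.mul_apply (N := Pᵀ),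
        Matrix.mul_apply (N := Qᵀ), transpose_apply, diagonal_apply_eq] at this
      rw [this, ← Finset.sum_add_distrib]
      exact Finset.sum_congr rfl fun j _ => by ring)
  have hlX : Real.log X.det = ∑ j, Real.log (l j) := by
    rw [hdX, Real.log_prod fun j _ => (hlp j).ne']
  have hlT : Real.log T.det = ∑ j, Real.log (t j) := by
    rw [hdT, Real.log_prod fun j _ => (htp j).ne']
  refine ⟨by rw [hdT]; exact Finset.prod_pos fun j _ => htp j, by rw [hlX, hlT]; exact hle, ?_⟩
  intro h
  rw [hlX, hlT] at h
  have h3 := heq h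
  have kP : diagonal l * Pᵀ = Pᵀ * diagonal t := by
    ext j i
    rw [diagonal_mul, mul_diagonal, transpose_apply]
    by_cases hp : P i j = 0
    · simp [hp]
    · rw [h3 i j (by positivity), mul_comm]
  have kQ : diagonal l * Qᵀ = Qᵀ * diagonal t := by
    ext j i
    rw [diagonal_mul, mul_diagonal, transpose_apply]
    by_cases hp : Q i j = 0
    · simp [hp]
    · rw [h3 i j (by positivity), mul_comm]
  constructor
  · calc X * Aᵀ = U * diagonal l * (Uᵀ * U) * Pᵀ * Vᵀ := by
          rw [hXU, hA]; simp only [transpose_mul, transpose_transpose, Matrix.mul_assoc]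
      _ = U * (diagonal l * Pᵀ) * Vᵀ := by rw [hU1]; simp only [Matrix.mul_one, Matrix.mul_assoc]
      _ = U * Pᵀ * (Vᵀ * V) * diagonal t * Vᵀ := by
          rw [kP, hV1]; simp only [Matrix.mul_one, Matrix.mul_assoc]
      _ = Aᵀ * T := by
          rw [hTV, hA]; simp only [transpose_mul, transpose_transpose, Matrix.mul_assoc]
  · calc X * Bᵀ = U * diagonal l * (Uᵀ * U) * Qᵀ * Vᵀ := by
          rw [hXU, hB]; simp only [transpose_mul, transpose_transpose, Matrix.mul_assoc]
      _ = U * (diagonal l * Qᵀ) * Vᵀ := by rw [hU1]; simp only [Matrix.mul_one, Matrix.mul_assoc]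
      _ = U * Qᵀ * (Vᵀ * V) * diagonal t * Vᵀ := by
          rw [kQ, hV1]; simp only [Matrix.mul_one, Matrix.mul_assoc]
      _ = Bᵀ * T := by
          rw [hTV, hB]; simp only [transpose_mul, transpose_transpose, Matrix.mul_assoc]

/-- Indecomposability of the pencil. -/
theorem aux_pencil {m : ℕ} (hm : 0 < m) (M : Matrix (Fin m) (Fin m) ℝ)
    (N : Matrix (Fin (m + 1)) (Fin (m + 1)) ℝ)
    (h1 : M * (canonU m)ᵀ = (canonU m)ᵀ * N) (h2 : M * (canonL m)ᵀ = (canonL m)ᵀ * N) :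
    M = M ⟨0, hm⟩ ⟨0, hm⟩ • 1 := by
  have hU : ∀ (a : Fin m) (i : Fin (m + 1)), canonU m i a = if i = a.castSucc then 1 else 0 := by
    intro a i; simp [canonU, Fin.ext_iff]
  have hL : ∀ (a : Fin m) (i : Fin (m + 1)), canonL m i a = if i = a.succ then 1 else 0 := by
    intro a i; simp [canonL, Fin.ext_iff]
  have e1 : ∀ (a : Fin m) (b : Fin (m + 1)), ∑ j, M a j * canonU m b j = N a.castSucc b := by
    intro a b
    have := congrFun (congrFun h1 a) b
    simpa [Matrix.mul_apply, hU] using this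
  have e2 : ∀ (a : Fin m) (b : Fin (m + 1)), ∑ j, M a j * canonL m b j = N a.succ b := by
    intro a b
    have := congrFun (congrFun h2 a) b
    simpa [Matrix.mul_apply, hL] using this
  have f1 : ∀ a b : Fin m, N a.castSucc b.castSucc = M a b := by
    intro a b; rw [← e1]; simp [hU]
  have f2 : ∀ a b : Fin m, N a.succ b.succ = M a b := by
    intro a b; rw [← e2]; simp [hL]
  have f3 : ∀ a : Fin m, N a.castSucc (Fin.last m) = 0 := by
    intro a; rw [← e1]
    refine Finset.sum_eq_zero fun j _ => ?_
    rw [hU, if_neg (Fin.castSucc_lt_last j).ne', mul_zero]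
  have f4 : ∀ a : Fin m, N a.succ 0 = 0 := by
    intro a; rw [← e2]
    refine Finset.sum_eq_zero fun j _ => ?_
    rw [hL, if_neg (Fin.succ_ne_zero j).symm, mul_zero]

  have t1 : ∀ (a b : ℕ) (ha : a + 1 < m) (hb : b + 1 < m),
      M ⟨a + 1, ha⟩ ⟨b + 1, hb⟩ = M ⟨a, by omega⟩ ⟨b, by omega⟩ := by
    intro a b ha hb
    rw [← f1, ← f2]; rfl
  have t2 : ∀ (a : ℕ) (ha : a + 1 < m), M ⟨a + 1, ha⟩ ⟨0, hm⟩ = 0 := by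
    intro a ha
    rw [← f1, ← f4 ⟨a, by omega⟩]; rfl
  have t3 : ∀ (a : ℕ) (ha : a + 1 < m), M ⟨a, by omega⟩ ⟨m - 1, by omega⟩ = 0 := by
    intro a ha
    rw [← f2, ← f3 ⟨a + 1, ha⟩]
    congr 1
    ext
    simp
    omega
  have d : ∀ (a : ℕ) (ha : a < m), M ⟨a, ha⟩ ⟨a, ha⟩ = M ⟨0, hm⟩ ⟨0, hm⟩ := by
    intro a
    induction a with
    | zero => intro _; rfl
    | succ a ih => intro ha; rw [t1, ih]
  have low : ∀ (b a : ℕ) (ha : a < m) (hb : b < m), b < a → M ⟨a, ha⟩ ⟨b, hb⟩ = 0 := by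
    intro b
    induction b with
    | zero =>
      intro a ha hb h
      obtain ⟨a, rfl⟩ : ∃ a', a = a' + 1 := ⟨a - 1, by omega⟩
      exact t2 a ha
    | succ b ih =>
      intro a ha hb h
      obtain ⟨a, rfl⟩ : ∃ a', a = a' + 1 := ⟨a - 1, by omega⟩
      rw [t1]
      exact ih _ _ _ (by omega)
  have up : ∀ (d a b : ℕ) (ha : a < m) (hb : b < m), a < b → b + d = m - 1 →
      M ⟨a, ha⟩ ⟨b, hb⟩ = 0 := by
    intro d
    induction d with
    | zero =>
      intro a b ha hb h hd
      obtain rfl : b = m - 1 := by omega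
      exact t3 a (by omega)
    | succ d ih =>
      intro a b ha hb h hd
      rw [← t1 a b (by omega) (by omega)]
      exact ih _ _ _ _ (by omega) (by omega)
  ext ⟨a, ha⟩ ⟨b, hb⟩
  rw [Matrix.smul_apply, Matrix.one_apply]
  rcases lt_trichotomy a b with h | h | h
  · rw [up (m - 1 - b) a b ha hb h (by omega), if_neg (by simp; omega), smul_zero]
  · subst h
    simp [d a ha]
  · rw [low b a ha hb h, if_neg (by simp; omega), smul_zero]

theorem aux_S0 (p : ℕ) : canonU (p + 1) * Phi0 (p + 1) * (canonU (p + 1))ᵀ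
    + canonL (p + 1) * Phi0 (p + 1) * (canonL (p + 1))ᵀ
    = diagonal fun i : Fin (p + 2) => ((p + 1).choose (i : ℕ) : ℝ) := by
  ext i k
  simp only [Phi0, Matrix.add_apply, Matrix.mul_apply (N := (canonU (p + 1))ᵀ),
    Matrix.mul_apply (N := (canonL (p + 1))ᵀ), mul_diagonal, transpose_apply, diagonal_apply]
  simp only [canonU, canonL, Matrix.of_apply, Nat.add_sub_cancel]
  by_cases hik : i = k
  · subst hik
    rw [if_pos rfl]
    have hA : ∑ j : Fin (p + 1), (if (i : ℕ) = j then (1 : ℝ) else 0) * (p.choose j : ℝ)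
        * (if (i : ℕ) = j then (1 : ℝ) else 0) = (p.choose i : ℝ) := by
      by_cases hi : (i : ℕ) < p + 1
      · rw [Finset.sum_eq_single (⟨i, hi⟩ : Fin (p + 1))]
        · simp
        · intro b _ hb
          rw [if_neg, mul_zero]
          intro h; exact hb (Fin.ext h.symm)
        · simp
      · rw [Nat.choose_eq_zero_of_lt (by omega), Finset.sum_eq_zero]
        · simp
        · intro j _
          rw [if_neg (by omega), mul_zero]
    rw [hA]
    induction i using Fin.cases with
    | zero => simp
    | succ i =>
      rw [Finset.sum_eq_single i]
      · simp [Nat.choose_succ_succ, add_comm]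
      · intro b _ hb
        rw [if_neg, mul_zero]
        intro h; apply hb; ext; simpa using h.symm
      · simp
  · rw [if_neg hik, Finset.sum_eq_zero, Finset.sum_eq_zero, add_zero]
    · intro j _
      by_cases h : (i : ℕ) = j + 1
      · rw [if_neg (c := (k : ℕ) = j + 1), mul_zero]
        intro h'; exact hik (Fin.ext (h.trans h'.symm))
      · simp [h]
    · intro j _
      by_cases h : (i : ℕ) = j
      · rw [if_neg (c := (k : ℕ) = j), mul_zero]
        intro h'; exact hik (Fin.ext (h.trans h'.symm))
      · simp [h]

theorem aux_W (m : ℕ) (w : Fin (m + 1) → ℝ) : (canonU m)ᵀ * diagonal w * canonU m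
    + (canonL m)ᵀ * diagonal w * canonL m
    = diagonal fun j : Fin m => w j.castSucc + w j.succ := by
  have hU : ∀ (a : Fin m) (i : Fin (m + 1)), canonU m i a = if i = a.castSucc then 1 else 0 := by
    intro a i; simp [canonU, Fin.ext_iff]
  have hL : ∀ (a : Fin m) (i : Fin (m + 1)), canonL m i a = if i = a.succ then 1 else 0 := by
    intro a i; simp [canonL, Fin.ext_iff]
  ext a b
  simp only [Matrix.add_apply, Matrix.mul_apply (N := canonU m),
    Matrix.mul_apply (N := canonL m), mul_diagonal, transpose_apply, diagonal_apply, hU, hL]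
  by_cases hab : a = b
  · subst hab; simp
  · simp [hab, Ne.symm hab]

theorem aux_binom (p j : ℕ) (hj : j ≤ p) : (((p + 1).choose j : ℝ))⁻¹ + (((p + 1).choose (j + 1) : ℝ))⁻¹
    = ((p : ℝ) + 2) / (p + 1) * ((p.choose j : ℝ))⁻¹ := by
  have h0 : (0 : ℝ) < p.choose j := by exact_mod_cast Nat.choose_pos hj
  have h1 : (0 : ℝ) < (p + 1).choose j := by exact_mod_cast Nat.choose_pos (by omega)
  have h2 : (0 : ℝ) < (p + 1).choose (j + 1) := by exact_mod_cast Nat.choose_pos (by omega)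
  have a1 : ((p : ℝ) + 1) * p.choose j = (p + 1).choose (j + 1) * (j + 1) := by
    exact_mod_cast Nat.add_one_mul_choose_eq p j
  have a2 : ((p : ℝ) + 1) * p.choose j = (p + 1).choose j * (p + 1 - j) := by
    have := Nat.choose_mul_succ_eq p j
    have h : ((p + 1 - j : ℕ) : ℝ) = p + 1 - j := by
      rw [Nat.cast_sub (by omega)]; push_cast; ring
    rw [← h, mul_comm]
    exact_mod_cast this
  have b1 : (((p + 1).choose (j + 1) : ℝ))⁻¹ = (j + 1) / ((p + 1) * p.choose j) := by
    rw [a1]; field_simp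
  have hpj : (0 : ℝ) < p + 1 - j := by
    have : (j : ℝ) ≤ p := by exact_mod_cast hj
    linarith
  have b2 : (((p + 1).choose j : ℝ))⁻¹ = (p + 1 - j) / ((p + 1) * p.choose j) := by
    rw [a2]; field_simp
  rw [b1, b2]
  field_simp
  ring

theorem aux_main (p : ℕ) (Φ : Matrix (Fin (p + 1)) (Fin (p + 1)) ℝ) (hΦ : Φ.PosDef) :
    g0 (Phi0 (p + 1)) ≤ g0 Φ ∧
      (g0 Φ = g0 (Phi0 (p + 1)) → ∃ r : ℝ, Φ = r • Phi0 (p + 1)) := by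
  have hc0 : ∀ j : Fin (p + 1), (0 : ℝ) < p.choose j := fun j => by
    exact_mod_cast Nat.choose_pos (by omega)
  have hc1 : ∀ j : Fin (p + 2), (0 : ℝ) < (p + 1).choose j := fun j => by
    exact_mod_cast Nat.choose_pos (by omega)
  obtain ⟨D, hD⟩ : ∃ D : Matrix (Fin (p + 1)) (Fin (p + 1)) ℝ,
    D = diagonal fun j : Fin (p + 1) => √(p.choose j : ℝ) := ⟨_, rfl⟩
  obtain ⟨D', hD'⟩ : ∃ D : Matrix (Fin (p + 1)) (Fin (p + 1)) ℝ,
    D = diagonal fun j : Fin (p + 1) => (√(p.choose j : ℝ))⁻¹ := ⟨_, rfl⟩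
  obtain ⟨E, hE⟩ : ∃ D : Matrix (Fin (p + 2)) (Fin (p + 2)) ℝ,
    D = diagonal fun j : Fin (p + 2) => (√((p + 1).choose j : ℝ))⁻¹ := ⟨_, rfl⟩
  obtain ⟨E', hE'⟩ : ∃ D : Matrix (Fin (p + 2)) (Fin (p + 2)) ℝ,
    D = diagonal fun j : Fin (p + 2) => √((p + 1).choose j : ℝ) := ⟨_, rfl⟩
  have hDt : Dᵀ = D := by rw [hD, diagonal_transpose]
  have hDt' : D'ᵀ = D' := by rw [hD', diagonal_transpose]
  have hEt : Eᵀ = E := by rw [hE, diagonal_transpose]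
  have hDD : D * D = Phi0 (p + 1) := by
    rw [hD, diagonal_mul_diagonal, Phi0]
    congr 1; ext j; rw [Real.mul_self_sqrt (hc0 j).le]; simp
  have hDD' : D * D' = 1 := by
    rw [hD, hD', diagonal_mul_diagonal, ← diagonal_one]
    congr 1; ext j; rw [mul_inv_cancel₀ (Real.sqrt_pos.2 (hc0 j)).ne']
  have hDinvD : D' * D = 1 := by
    rw [hD, hD', diagonal_mul_diagonal, ← diagonal_one]
    congr 1; ext j; rw [inv_mul_cancel₀ (Real.sqrt_pos.2 (hc0 j)).ne']
  have hEE' : E * E' = 1 := by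
    rw [hE, hE', diagonal_mul_diagonal, ← diagonal_one]
    congr 1; ext j; rw [inv_mul_cancel₀ (Real.sqrt_pos.2 (hc1 j)).ne']
  have hEE : E * E = diagonal fun j : Fin (p + 2) => (((p + 1).choose j : ℝ))⁻¹ := by
    rw [hE, diagonal_mul_diagonal]
    congr 1; ext j; rw [← mul_inv, Real.mul_self_sqrt (hc1 j).le]
  have hS0E : E * (diagonal fun i : Fin (p + 2) => ((p + 1).choose (i : ℕ) : ℝ)) * E = 1 := by
    have : (diagonal fun i : Fin (p + 2) => ((p + 1).choose (i : ℕ) : ℝ)) = E' * E' := by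
      rw [hE', diagonal_mul_diagonal]
      congr 1; ext j; rw [Real.mul_self_sqrt (hc1 j).le]
    have hEinvE : E' * E = 1 := mul_eq_one_comm.1 hEE'
    rw [this, ← Matrix.mul_assoc, hEE', Matrix.one_mul, hEinvE]
  obtain ⟨Y, hY⟩ : ∃ Y, Y = canonU (p + 1) := ⟨_, rfl⟩
  obtain ⟨Z, hZ⟩ : ∃ Z, Z = canonL (p + 1) := ⟨_, rfl⟩
  have hS0 := aux_S0 p
  have hW := aux_W (p + 1) (fun j : Fin (p + 2) => (((p + 1).choose j : ℝ))⁻¹)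
  rw [← hEE] at hW
  have hpen := aux_pencil (Nat.succ_pos p) (D' * D' * Φ)
    (E * E * (canonU (p + 1) * Φ * (canonU (p + 1))ᵀ + canonL (p + 1) * Φ * (canonL (p + 1))ᵀ))
  unfold g0
  rw [← hY, ← hZ] at *
  obtain ⟨S, hS⟩ : ∃ S, S = Y * Φ * Yᵀ + Z * Φ * Zᵀ := ⟨_, rfl⟩
  have hpΦ := hΦ.det_pos
  have h1 : (E * Y * D) * (E * Y * D)ᵀ + (E * Z * D) * (E * Z * D)ᵀ = 1 := by
    rw [← hS0E, ← hS0, ← hDD]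
    simp only [transpose_mul, hDt, hEt, Matrix.mul_assoc, Matrix.mul_add, Matrix.add_mul]
  have h2 : (E * Y * D)ᵀ * (E * Y * D) + (E * Z * D)ᵀ * (E * Z * D)
      = (((p : ℝ) + 2) / (p + 1)) • 1 := by
    calc _ = D * (Yᵀ * (E * E) * Y + Zᵀ * (E * E) * Z) * D := by
          simp only [transpose_mul, hDt, hEt, Matrix.mul_assoc, Matrix.mul_add, Matrix.add_mul]
      _ = _ := by
          rw [hW, hD, diagonal_mul_diagonal, diagonal_mul_diagonal, ← diagonal_one,
            ← diagonal_smul]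
          congr 1
          ext j
          have hs := Real.mul_self_sqrt (hc0 j).le
          have hb := aux_binom p j (by omega)
          simp only [Fin.val_castSucc, Fin.val_succ, Pi.smul_apply, smul_eq_mul, mul_one]
          rw [hb]
          calc _ = ((p : ℝ) + 2) / (p + 1) * ((√(p.choose j : ℝ) * √(p.choose j : ℝ))
                * (p.choose j : ℝ)⁻¹) := by ring
            _ = _ := by rw [hs, mul_inv_cancel₀ (hc0 j).ne', mul_one]
  have hX : (D' * Φ * D').PosDef := by
    have hinj : Function.Injective D'.mulVec := by
      intro a b h
      have := congrArg (D.mulVec) h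
      simpa [mulVec_mulVec, hDD'] using this
    have := hΦ.conjTranspose_mul_mul_same hinj
    rwa [conjTranspose_eq_transpose_of_trivial, hDt'] at this
  have hT : E * S * E = (E * Y * D) * (D' * Φ * D') * (E * Y * D)ᵀ
      + (E * Z * D) * (D' * Φ * D') * (E * Z * D)ᵀ := by
    calc E * S * E = E * Y * (D * D') * Φ * (D' * D) * Yᵀ * E
          + E * Z * (D * D') * Φ * (D' * D) * Zᵀ * E := by
          rw [hDD', hDinvD, hS]
          simp only [Matrix.mul_one, Matrix.mul_assoc, Matrix.mul_add, Matrix.add_mul]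
      _ = _ := by simp only [transpose_mul, hDt, hEt, Matrix.mul_assoc]
  obtain ⟨hpos, hle, heq⟩ := aux_core _ _ _ h1 h2 _ hX _ hT
  have hdE : E.det * E.det * (Y * Phi0 (p + 1) * Yᵀ + Z * Phi0 (p + 1) * Zᵀ).det = 1 := by
    have := congrArg det hS0E
    rw [det_mul, det_mul, det_one] at this
    rw [hS0]; linarith
  have hdD : D'.det * D'.det * (Phi0 (p + 1)).det = 1 := by
    have := congrArg det hDinvD
    rw [det_mul, det_one] at this
    rw [← hDD, det_mul]
    linear_combination (D'.det * D.det + 1) * this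
  have hlS : Real.log (E * S * E).det = Real.log S.det
      - Real.log (Y * Phi0 (p + 1) * Yᵀ + Z * Phi0 (p + 1) * Zᵀ).det := by
    have h0 : (Y * Phi0 (p + 1) * Yᵀ + Z * Phi0 (p + 1) * Zᵀ).det ≠ 0 := by
      intro h; rw [h] at hdE; simp at hdE
    have h3 : S.det = (E * S * E).det
        * (Y * Phi0 (p + 1) * Yᵀ + Z * Phi0 (p + 1) * Zᵀ).det := by
      rw [det_mul, det_mul]; linear_combination (- S.det) * hdE
    rw [h3, Real.log_mul hpos.ne' h0]; ring
  have hlΦ : Real.log (D' * Φ * D').det = Real.log Φ.det - Real.log (Phi0 (p + 1)).det := by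
    have h0 : (Phi0 (p + 1)).det ≠ 0 := by
      intro h; rw [h] at hdD; simp at hdD
    have h3 : Φ.det = (D' * Φ * D').det * (Phi0 (p + 1)).det := by
      rw [det_mul, det_mul]; linear_combination (- Φ.det) * hdD
    rw [h3, Real.log_mul hX.det_pos.ne' h0]; ring
  rw [hlS, hlΦ] at hle heq
  rw [← hS] at hpen ⊢
  have hp1 : (0 : ℝ) < (p : ℝ) + 1 := by positivity
  have hmul : ∀ x : ℝ, ((p : ℝ) + 1) * (((p : ℝ) + 2) / (p + 1) * x) = (p + 2) * x := by
    intro x; field_simp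
  constructor
  · have := mul_le_mul_of_nonneg_left hle hp1.le
    rw [hmul] at this
    push_cast
    linarith
  · intro h
    push_cast at h
    obtain ⟨hA, hB⟩ := heq (by
      apply mul_left_cancel₀ hp1.ne'
      rw [hmul]
      linarith)
    have key : ∀ R : Matrix (Fin (p + 2)) (Fin (p + 1)) ℝ,
        D' * Φ * D' * (E * R * D)ᵀ = (E * R * D)ᵀ * (E * S * E) →
        D' * D' * Φ * Rᵀ = Rᵀ * (E * E * S) := by
      intro R hR
      calc D' * D' * Φ * Rᵀ = D' * (D' * Φ * (D' * D) * Rᵀ * (E * E')) := by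
            rw [hDinvD, hEE']; simp only [Matrix.mul_one, Matrix.mul_assoc]
        _ = D' * (D' * Φ * D' * (E * R * D)ᵀ) * E' := by
            simp only [transpose_mul, hDt, hEt, Matrix.mul_assoc]
        _ = (D' * D) * Rᵀ * (E * E) * S * (E * E') := by
            rw [hR]; simp only [transpose_mul, hDt, hEt, Matrix.mul_assoc]
        _ = _ := by rw [hDinvD, hEE']; simp only [Matrix.mul_one, Matrix.one_mul, Matrix.mul_assoc]
    have hM := hpen (key Y hA) (key Z hB)
    obtain ⟨r, hr⟩ : ∃ r : ℝ, D' * D' * Φ = r • 1 := ⟨_, hM⟩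
    refine ⟨r, ?_⟩
    · calc Φ = D * (D * D') * D' * Φ := by rw [hDD', Matrix.mul_one, hDD', Matrix.one_mul]
        _ = (D * D) * (D' * D' * Φ) := by simp only [Matrix.mul_assoc]
        _ = _ := by rw [hr, hDD, Matrix.mul_smul, Matrix.mul_one]

/-- On positive definite matrices with `(1,1)` entry equal to `1`, the function `g_0` is
uniquely minimized by the diagonal matrix of binomial coefficients `Φ_0`. -/
theorem stmt17 {m : ℕ} (hm : 2 ≤ m) :
    ∀ Φ : Matrix (Fin m) (Fin m) ℝ, Φ.PosDef →
      Φ ⟨0, by omega⟩ ⟨0, by omega⟩ = 1 →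
      (g0 (Phi0 m) ≤ g0 Φ ∧ (g0 Φ = g0 (Phi0 m) ↔ Φ = Phi0 m)) := by
  intro Φ hΦ h11
  obtain ⟨p, rfl⟩ : ∃ p, m = p + 1 := ⟨m - 1, by omega⟩
  obtain ⟨h1, h2⟩ := aux_main p Φ hΦ
  refine ⟨h1, fun h => ?_, fun h => by rw [h]⟩
  obtain ⟨r, hr⟩ := h2 h
  have hr1 : r = 1 := by
    rw [hr] at h11
    simpa [Phi0] using h11
  rw [hr, hr1, one_smul]
end
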